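/- arXiv:2212.00315 — 10 statements merged into one kernel-verified Lean document; each statement's English description precedes it below -/
import Mathlib

section
/- Let (T(t))_{t≥0} be a bounded C₀-semigroup on a complex Hilbert space X with generator A, and let C : D(A) → X be a linear map for which there exists c₀ > 0 with ‖Cx‖ ≤ c₀(‖x‖ + ‖Ax‖) for all x ∈ D(A), such that T(t)Cx = C T(t)x for all x ∈ D(A) and all t ≥ 0. Assume that F : (0,∞) → [0,∞) satisfies ‖C R(λ,A) x‖ ≤ F(Re λ) ‖x‖ for all λ with Re λ > 0 and all x ∈ X. Then there exists M > 0 (one may take M = √2 e c² with c = sup_{t≥0} ‖T(t)‖) such that ‖C T(t) x‖ ≤ M (F(1/t)/t) ‖x‖ for all t > 0 and all x ∈ D(A); in particular, for each t > 0 the map x ↦ C T(t)x extends to a bounded linear operator on X of norm at most M F(1/t)/t. -/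
open MeasureTheory FourierTransform Set Filter Topology

/-- The `L²`-Fourier transform of an integrable, square-integrable function is represented by its
Fourier integral. -/
theorem fourier_toLp_ae_eq {F : Type*} [NormedAddCommGroup F] [InnerProductSpace ℂ F]
    [CompleteSpace F] {f : ℝ → F} (hf : Integrable f) (hf2 : MemLp f 2) :
    (𝓕 (hf2.toLp f) : Lp F 2 (volume : Measure ℝ)) =ᵐ[volume] 𝓕 f := by
  have hcont : Continuous (𝓕 f) :=
    VectorFourier.fourierIntegral_continuous Real.continuous_fourierChar
      (by fun_prop) hf
  refine ae_eq_of_integral_contDiff_smul_eq ((Lp.memLp _).locallyIntegrable one_le_two)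
    hcont.locallyIntegrable fun g g_smooth g_cpt => ?_
  have hg : HasCompactSupport (Complex.ofRealCLM ∘ g) := g_cpt.comp_left rfl
  set G : SchwartzMap ℝ ℂ := hg.toSchwartzMap (by fun_prop)
  have hG : ∀ x, G x = (g x : ℂ) := fun x => rfl
  have h1 := congrArg (fun u => u G) (Lp.fourier_toTemperedDistribution_eq (hf2.toLp f))
  simp only [TemperedDistribution.fourier_apply, Lp.toTemperedDistribution_apply] at h1
  have h2 : ∫ x, (𝓕 G) x • (hf2.toLp f) x = ∫ x, (𝓕 G) x • f x :=
    integral_congr_ae (by filter_upwards [hf2.coeFn_toLp] with x hx; rw [hx])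
  have hGint : Integrable G volume := G.integrable (μ := volume)
  have h3 := VectorFourier.integral_fourierIntegral_smul_eq_flip (e := Real.fourierChar)
    (L := innerₗ ℝ) Real.continuous_fourierChar (by fun_prop) hGint hf
  rw [flip_innerₗ] at h3
  calc ∫ x, g x • (𝓕 (hf2.toLp f) : Lp F 2 (volume : Measure ℝ)) x
      = ∫ x, G x • (𝓕 (hf2.toLp f) : Lp F 2 (volume : Measure ℝ)) x := by simp [hG]
    _ = ∫ x, (𝓕 G) x • f x := by rw [← h1, h2]
    _ = ∫ x, G x • 𝓕 f x := h3
    _ = ∫ x, g x • 𝓕 f x := by simp [hG]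

theorem MeasureTheory.MemLp.norm_toLp_two_sq {α F : Type*} [MeasurableSpace α] {μ : Measure α}
    [NormedAddCommGroup F] [InnerProductSpace ℂ F] {f : α → F} (hf : MemLp f 2 μ) :
    ‖hf.toLp f‖ ^ 2 = ∫ x, ‖f x‖ ^ 2 ∂μ := by
  have h := L2.inner_def (𝕜 := ℂ) (hf.toLp f) (hf.toLp f)
  have h2 : ∫ x, inner ℂ (hf.toLp f x) (hf.toLp f x) ∂μ = ∫ x, ((‖f x‖ ^ 2 : ℝ) : ℂ) ∂μ :=
    integral_congr_ae (by
      filter_upwards [hf.coeFn_toLp] with x hx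
      rw [hx, inner_self_eq_norm_sq_to_K]; simp)
  rw [inner_self_eq_norm_sq_to_K, h2, integral_complex_ofReal] at h
  apply Complex.ofReal_injective
  rw [← h]
  simp

/-- Plancherel's theorem for the Fourier integral of Hilbert-space-valued functions. -/
theorem memLp_fourier_and_integral_norm_sq_fourier {F : Type*} [NormedAddCommGroup F]
    [InnerProductSpace ℂ F] [CompleteSpace F] {f : ℝ → F} (hf : Integrable f)
    (hf2 : MemLp f 2) :
    MemLp (𝓕 f) 2 ∧ ∫ x, ‖𝓕 f x‖ ^ 2 = ∫ x, ‖f x‖ ^ 2 := by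
  have hae := fourier_toLp_ae_eq hf hf2
  have hm : MemLp (𝓕 f) 2 := (memLp_congr_ae hae).1 (Lp.memLp _)
  refine ⟨hm, ?_⟩
  rw [← hm.norm_toLp_two_sq, ← hf2.norm_toLp_two_sq, ← Lp.norm_fourier_eq (hf2.toLp f)]
  congr 2
  exact Lp.ext (hm.coeFn_toLp.trans hae.symm)

theorem integral_Ioi_of_hasDerivWithinAt_of_tendsto_zero {E : Type*} [NormedAddCommGroup E]
    [NormedSpace ℝ E] [CompleteSpace E] {f f' : ℝ → E} {a : ℝ}
    (hcont : ContinuousOn f (Ici a))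
    (hderiv : ∀ x ∈ Ioi a, HasDerivWithinAt f (f' x) (Ioi x) x)
    (f'int : IntegrableOn f' (Ioi a)) (hlim : Tendsto f atTop (𝓝 0)) :
    ∫ x in Ioi a, f' x = -f a := by
  refine tendsto_nhds_unique (intervalIntegral_tendsto_integral_Ioi a f'int tendsto_id) ?_
  have h : Tendsto (fun b => f b - f a) atTop (𝓝 (0 - f a)) := hlim.sub_const _
  rw [zero_sub] at h
  refine h.congr' ?_
  filter_upwards [eventually_ge_atTop a] with b hb
  refine (intervalIntegral.integral_eq_sub_of_hasDeriv_right_of_le hb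
    (hcont.mono Icc_subset_Ici_self) (fun x hx => hderiv x hx.1) ?_).symm
  exact (intervalIntegrable_iff_integrableOn_Ioc_of_le hb).2 (f'int.mono_set Ioc_subset_Ioi_self)

theorem integrableOn_pow_mul_exp_neg_mul_Ioi (n : ℕ) {b : ℝ} (hb : 0 < b) :
    IntegrableOn (fun s : ℝ => s ^ n * Real.exp (-b * s)) (Ioi 0) := by
  have h := integrableOn_rpow_mul_exp_neg_mul_rpow (p := 1) (s := n) (b := b)
    (by have := n.cast_nonneg (α := ℝ); linarith) one_pos hb
  simpa using h

theorem tendsto_pow_mul_exp_neg_mul_atTop_nhds_zero (n : ℕ) {b : ℝ} (hb : 0 < b) :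
    Tendsto (fun s : ℝ => s ^ n * Real.exp (-b * s)) atTop (𝓝 0) := by
  simpa using tendsto_rpow_mul_exp_neg_mul_atTop_nhds_zero n b hb

/-- The weight `s ↦ sⁿ e^{-λs}`. -/
noncomputable def laplaceWeight (n : ℕ) (lam : ℂ) (s : ℝ) : ℂ :=
  (s : ℂ) ^ n * Complex.exp (-lam * s)

theorem continuous_laplaceWeight (n : ℕ) (lam : ℂ) : Continuous (laplaceWeight n lam) := by
  unfold laplaceWeight; fun_prop

theorem norm_laplaceWeight (n : ℕ) (lam : ℂ) {s : ℝ} (hs : 0 ≤ s) :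
    ‖laplaceWeight n lam s‖ = s ^ n * Real.exp (-lam.re * s) := by
  simp [laplaceWeight, Complex.norm_exp, abs_of_nonneg hs]

theorem integrableOn_laplaceWeight (n : ℕ) {lam : ℂ} (hlam : 0 < lam.re) :
    IntegrableOn (laplaceWeight n lam) (Ioi 0) := by
  refine (integrableOn_pow_mul_exp_neg_mul_Ioi n hlam).mono'
    (continuous_laplaceWeight n lam).aestronglyMeasurable ?_
  filter_upwards [ae_restrict_mem measurableSet_Ioi] with s hs
  exact (norm_laplaceWeight n lam (le_of_lt hs)).le

theorem tendsto_laplaceWeight (n : ℕ) {lam : ℂ} (hlam : 0 < lam.re) :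
    Tendsto (laplaceWeight n lam) atTop (𝓝 0) := by
  refine squeeze_zero_norm' ?_ (tendsto_pow_mul_exp_neg_mul_atTop_nhds_zero n hlam)
  filter_upwards [eventually_ge_atTop 0] with s hs
  exact (norm_laplaceWeight n lam hs).le

theorem hasDerivAt_laplaceWeight_zero (lam : ℂ) (s : ℝ) :
    HasDerivAt (laplaceWeight 0 lam) (-lam * laplaceWeight 0 lam s) s := by
  have h : HasDerivAt (fun s : ℝ => Complex.exp (-lam * s))
      (Complex.exp (-lam * s) * (-lam * 1)) s :=
    ((Complex.ofRealCLM.hasDerivAt (x := s)).const_mul (-lam)).cexp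
  have e : laplaceWeight 0 lam = fun s : ℝ => Complex.exp (-lam * s) := by
    ext s; simp [laplaceWeight]
  rw [e]
  convert! h using 1
  ring

theorem hasDerivAt_laplaceWeight_one (lam : ℂ) (s : ℝ) :
    HasDerivAt (laplaceWeight 1 lam) (laplaceWeight 0 lam s - lam * laplaceWeight 1 lam s) s := by
  have h := (Complex.ofRealCLM.hasDerivAt (x := s)).mul (hasDerivAt_laplaceWeight_zero lam s)
  have e : laplaceWeight 1 lam = ⇑Complex.ofRealCLM * laplaceWeight 0 lam := by
    ext s; simp [laplaceWeight]
  rw [e]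
  convert! h using 1
  simp [laplaceWeight]
  ring


/-- `T` is a `C₀`-semigroup bounded by `c`. -/
structure IsBoundedC0Semigroup {X : Type*} [NormedAddCommGroup X] [NormedSpace ℂ X]
    (T : ℝ → X →L[ℂ] X) (c : ℝ) : Prop where
  zero : T 0 = 1
  add : ∀ s t : ℝ, 0 ≤ s → 0 ≤ t → T (s + t) = T s ∘L T t
  continuousOn : ∀ x : X, ContinuousOn (fun t : ℝ => T t x) (Ici 0)
  norm_le : ∀ t : ℝ, 0 ≤ t → ‖T t‖ ≤ c

/-- `A` with domain `Dom` is the infinitesimal generator of `T`. -/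
def IsGeneratorOf {X : Type*} [NormedAddCommGroup X] [NormedSpace ℂ X]
    (Dom : Set X) (A : X → X) (T : ℝ → X →L[ℂ] X) : Prop :=
  ∀ x y, (x ∈ Dom ∧ A x = y) ↔
    Tendsto (fun t : ℝ => (t : ℂ)⁻¹ • (T t x - x)) (𝓝[>] 0) (𝓝 y)

/-- `R` is the resolvent of `A` on the open right half-plane. -/
structure IsResolventOf {X : Type*} [NormedAddCommGroup X] [NormedSpace ℂ X]
    (R : ℂ → X →L[ℂ] X) (Dom : Set X) (A : X → X) : Prop where
  mem_dom : ∀ lam : ℂ, 0 < lam.re → ∀ x, R lam x ∈ Dom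
  sub_apply : ∀ lam : ℂ, 0 < lam.re → ∀ x, lam • R lam x - A (R lam x) = x
  apply_sub : ∀ lam : ℂ, 0 < lam.re → ∀ x ∈ Dom, R lam (lam • x - A x) = x

section Generator

variable {X : Type*} [NormedAddCommGroup X] [NormedSpace ℂ X] {T : ℝ → X →L[ℂ] X}
  {Dom : Set X} {A : X → X}

theorem IsGeneratorOf.tendsto (hA : IsGeneratorOf Dom A T) {x : X} (hx : x ∈ Dom) :
    Tendsto (fun t : ℝ => (t : ℂ)⁻¹ • (T t x - x)) (𝓝[>] 0) (𝓝 (A x)) :=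
  (hA x (A x)).1 ⟨hx, rfl⟩

theorem IsGeneratorOf.mem_of_tendsto (hA : IsGeneratorOf Dom A T) {x y : X}
    (h : Tendsto (fun t : ℝ => (t : ℂ)⁻¹ • (T t x - x)) (𝓝[>] 0) (𝓝 y)) : x ∈ Dom :=
  ((hA x y).2 h).1

/-- The domain of the generator as a linear subspace. -/
def IsGeneratorOf.domain (hA : IsGeneratorOf Dom A T) : Submodule ℂ X where
  carrier := Dom
  add_mem' {x y} hx hy := hA.mem_of_tendsto <|
    ((hA.tendsto hx).add (hA.tendsto hy)).congr fun t => by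
      rw [map_add, ← smul_add]; congr 1; abel
  zero_mem' := hA.mem_of_tendsto (y := 0) (by simp)
  smul_mem' a x hx := hA.mem_of_tendsto <|
    ((hA.tendsto hx).const_smul a).congr fun t => by
      rw [map_smul, smul_comm, smul_sub]

end Generator

namespace IsBoundedC0Semigroup

variable {X : Type*} [NormedAddCommGroup X] [NormedSpace ℂ X] {T : ℝ → X →L[ℂ] X} {c : ℝ}
  {Dom : Set X} {A : X → X} {R : ℂ → X →L[ℂ] X}

theorem nonneg (hT : IsBoundedC0Semigroup T c) : 0 ≤ c :=
  (norm_nonneg _).trans (hT.norm_le 0 le_rfl)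

theorem apply_add (hT : IsBoundedC0Semigroup T c) {s t : ℝ} (hs : 0 ≤ s) (ht : 0 ≤ t) (x : X) :
    T (s + t) x = T s (T t x) := by
  rw [hT.add s t hs ht]; rfl

theorem norm_apply_le (hT : IsBoundedC0Semigroup T c) {t : ℝ} (ht : 0 ≤ t) (x : X) :
    ‖T t x‖ ≤ c * ‖x‖ :=
  (T t).le_of_opNorm_le (hT.norm_le t ht) x

theorem apply_mem_dom (hT : IsBoundedC0Semigroup T c) (hA : IsGeneratorOf Dom A T) {s : ℝ}
    (hs : 0 ≤ s) {x : X} (hx : x ∈ Dom) : T s x ∈ Dom ∧ A (T s x) = T s (A x) := by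
  refine (hA _ _).2 ((((T s).continuous.tendsto _).comp (hA.tendsto hx)).congr' ?_)
  filter_upwards [self_mem_nhdsWithin] with t ht
  have ht : 0 ≤ t := le_of_lt ht
  simp only [Function.comp, map_smul, map_sub]
  rw [← hT.apply_add hs ht, add_comm, hT.apply_add ht hs]

theorem hasDerivWithinAt (hT : IsBoundedC0Semigroup T c) (hA : IsGeneratorOf Dom A T) {s : ℝ}
    (hs : 0 ≤ s) {x : X} (hx : x ∈ Dom) :
    HasDerivWithinAt (fun t => T t x) (T s (A x)) (Ioi s) s := by
  rw [hasDerivWithinAt_iff_tendsto_slope' self_notMem_Ioi]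
  have h1 : Tendsto (fun t : ℝ => t - s) (𝓝[>] s) (𝓝[>] 0) := by
    refine tendsto_nhdsWithin_iff.2 ⟨?_, ?_⟩
    · have : Tendsto (fun t : ℝ => t - s) (𝓝 s) (𝓝 (s - s)) := tendsto_id.sub_const s
      rw [sub_self] at this
      exact this.mono_left nhdsWithin_le_nhds
    · filter_upwards [self_mem_nhdsWithin] with t ht
      exact sub_pos.2 (mem_Ioi.1 ht)
  refine ((((T s).continuous.tendsto _).comp (hA.tendsto hx)).comp h1).congr' ?_
  filter_upwards [self_mem_nhdsWithin] with t ht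
  have h2 : T t x = T s (T (t - s) x) := by
    rw [← hT.apply_add hs (sub_nonneg.2 (le_of_lt ht)), add_sub_cancel]
  simp only [Function.comp, map_smul, map_sub, slope, vsub_eq_sub]
  rw [← h2, ← Complex.ofReal_inv, Complex.coe_smul]

theorem apply_resolvent (hT : IsBoundedC0Semigroup T c) (hA : IsGeneratorOf Dom A T)
    (hR : IsResolventOf R Dom A) {lam : ℂ} (hlam : 0 < lam.re) {s : ℝ} (hs : 0 ≤ s) (x : X) :
    T s (R lam x) = R lam (T s x) := by
  obtain ⟨h1, h2⟩ := hT.apply_mem_dom hA hs (hR.mem_dom lam hlam x)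
  rw [← hR.apply_sub lam hlam _ h1, h2, ← map_smul, ← map_sub, hR.sub_apply lam hlam]

theorem integrableOn_smul (hT : IsBoundedC0Semigroup T c) {w : ℝ → ℂ} (hw : Continuous w)
    (hint : IntegrableOn w (Ioi 0)) (x : X) : IntegrableOn (fun s => w s • T s x) (Ioi 0) := by
  refine (hint.norm.mul_const (c * ‖x‖)).mono'
    ((hw.continuousOn.smul ((hT.continuousOn x).mono Ioi_subset_Ici_self)).aestronglyMeasurable
      measurableSet_Ioi) ?_
  filter_upwards [ae_restrict_mem measurableSet_Ioi] with s hs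
  rw [norm_smul]
  gcongr
  exact hT.norm_apply_le (le_of_lt hs) x

theorem integrableOn_laplaceWeight_smul (hT : IsBoundedC0Semigroup T c) (n : ℕ) {lam : ℂ}
    (hlam : 0 < lam.re) (x : X) :
    IntegrableOn (fun s => laplaceWeight n lam s • T s x) (Ioi 0) :=
  hT.integrableOn_smul (continuous_laplaceWeight n lam) (integrableOn_laplaceWeight n hlam) x

theorem integral_deriv_smul_resolvent [CompleteSpace X] (hT : IsBoundedC0Semigroup T c)
    (hA : IsGeneratorOf Dom A T) (hR : IsResolventOf R Dom A) {lam : ℂ} (hlam : 0 < lam.re)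
    (n : ℕ) {w : ℝ → ℂ} (hw : Continuous w) (hwint : IntegrableOn w (Ioi 0))
    (hderiv : ∀ s, HasDerivAt (laplaceWeight n lam) (w s - lam * laplaceWeight n lam s) s)
    (x : X) :
    ∫ s in Ioi 0, laplaceWeight n lam s • T s x =
      (∫ s in Ioi 0, w s • T s (R lam x)) + laplaceWeight n lam 0 • R lam x := by
  have hAR : A (R lam x) = lam • R lam x - x := by
    rw [eq_sub_iff_add_eq, ← eq_sub_iff_add_eq', hR.sub_apply lam hlam]
  have h1 := hT.integrableOn_smul hw hwint (R lam x)
  have h2 := hT.integrableOn_laplaceWeight_smul n hlam x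
  have key := integral_Ioi_of_hasDerivWithinAt_of_tendsto_zero
    (f := fun s => laplaceWeight n lam s • T s (R lam x))
    (f' := fun s => w s • T s (R lam x) - laplaceWeight n lam s • T s x) (a := 0)
    ((continuous_laplaceWeight n lam).continuousOn.smul (hT.continuousOn _)) ?_ (h1.sub h2) ?_
  · rw [integral_sub h1 h2, hT.zero] at key
    simp only [one_apply_eq_self] at key
    rw [sub_eq_iff_eq_add] at key
    rw [key]; abel
  · intro s hs
    convert! (hderiv s).hasDerivWithinAt.smul
      (hT.hasDerivWithinAt hA (le_of_lt hs) (hR.mem_dom lam hlam x)) using 1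
    rw [hAR]
    simp only [map_sub, map_smul]
    module
  · have h3 := (tendsto_laplaceWeight n hlam).norm.mul_const (c * ‖R lam x‖)
    rw [norm_zero, zero_mul] at h3
    refine squeeze_zero_norm' ?_ h3
    filter_upwards [eventually_ge_atTop 0] with s hs
    rw [norm_smul]
    gcongr
    exact hT.norm_apply_le hs _

theorem integral_laplaceWeight_zero_smul [CompleteSpace X] (hT : IsBoundedC0Semigroup T c)
    (hA : IsGeneratorOf Dom A T) (hR : IsResolventOf R Dom A) {lam : ℂ} (hlam : 0 < lam.re)
    (x : X) : ∫ s in Ioi 0, laplaceWeight 0 lam s • T s x = R lam x := by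
  have h := hT.integral_deriv_smul_resolvent hA hR hlam 0 (w := 0) continuous_const
    integrableOn_zero (fun s => by simpa using hasDerivAt_laplaceWeight_zero lam s) x
  simpa [laplaceWeight] using h

theorem integral_laplaceWeight_one_smul [CompleteSpace X] (hT : IsBoundedC0Semigroup T c)
    (hA : IsGeneratorOf Dom A T) (hR : IsResolventOf R Dom A) {lam : ℂ} (hlam : 0 < lam.re)
    (x : X) : ∫ s in Ioi 0, laplaceWeight 1 lam s • T s x = R lam (R lam x) := by
  rw [hT.integral_deriv_smul_resolvent hA hR hlam 1 (continuous_laplaceWeight 0 lam)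
    (integrableOn_laplaceWeight 0 hlam) (hasDerivAt_laplaceWeight_one lam) x,
    hT.integral_laplaceWeight_zero_smul hA hR hlam]
  simp [laplaceWeight]

/-- A bounded operator commuting with the semigroup commutes with the resolvent. -/
theorem commute_resolvent [CompleteSpace X] (hT : IsBoundedC0Semigroup T c)
    (hA : IsGeneratorOf Dom A T) (hR : IsResolventOf R Dom A) {lam : ℂ} (hlam : 0 < lam.re)
    (B : X →L[ℂ] X) (hB : ∀ s, 0 ≤ s → ∀ x, T s (B x) = B (T s x)) (x : X) :
    R lam (B x) = B (R lam x) := by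
  rw [← hT.integral_laplaceWeight_zero_smul hA hR hlam,
    ← hT.integral_laplaceWeight_zero_smul hA hR hlam,
    ← B.integral_comp_comm (hT.integrableOn_laplaceWeight_smul 0 hlam x)]
  refine setIntegral_congr_fun measurableSet_Ioi fun s hs => ?_
  simp only [map_smul, hB s (le_of_lt hs)]

theorem dense_dom [CompleteSpace X] (hT : IsBoundedC0Semigroup T c)
    (hA : IsGeneratorOf Dom A T) (hR : IsResolventOf R Dom A) : Dense Dom := by
  intro x
  have hlim : Tendsto (fun n : ℝ => ∫ u in Ioi (0 : ℝ), laplaceWeight 0 1 u • T (n⁻¹ * u) x)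
      atTop (𝓝 (∫ u in Ioi (0 : ℝ), laplaceWeight 0 1 u • x)) := by
    refine tendsto_integral_filter_of_dominated_convergence
      (fun u => ‖laplaceWeight 0 1 u‖ * (c * ‖x‖)) ?_ ?_
      ((integrableOn_laplaceWeight 0 (by simp)).norm.mul_const _) ?_
    · filter_upwards [eventually_gt_atTop 0] with n hn
      refine ContinuousOn.aestronglyMeasurable ?_ measurableSet_Ioi
      refine (continuous_laplaceWeight 0 1).continuousOn.smul
        ((hT.continuousOn x).comp (by fun_prop) fun u hu => ?_)
      exact mul_nonneg (inv_pos.2 hn).le (le_of_lt hu)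
    · filter_upwards [eventually_gt_atTop 0] with n hn
      filter_upwards [ae_restrict_mem measurableSet_Ioi] with u hu
      rw [norm_smul]
      gcongr
      exact hT.norm_apply_le (mul_nonneg (inv_pos.2 hn).le (le_of_lt hu)) x
    · filter_upwards [ae_restrict_mem measurableSet_Ioi] with u hu
      have h0 : Tendsto (fun n : ℝ => n⁻¹ * u) atTop (𝓝[Ici 0] 0) := by
        refine tendsto_nhdsWithin_iff.2 ⟨?_, ?_⟩
        · simpa using tendsto_inv_atTop_zero.mul_const u
        · filter_upwards [eventually_gt_atTop 0] with n hn
          exact mul_nonneg (inv_pos.2 hn).le (le_of_lt hu)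
      have h1 := ((hT.continuousOn x 0 (mem_Ici.2 le_rfl)).tendsto.comp h0).const_smul
        (laplaceWeight 0 1 u)
      simpa [hT.zero, Function.comp_def] using h1
  have hx : ∫ u in Ioi (0 : ℝ), laplaceWeight 0 1 u • x = x := by
    have h := integral_exp_mul_complex_Ioi (a := -1) (by simp) 0
    rw [integral_smul_const]
    simp only [laplaceWeight, pow_zero, one_mul]
    rw [h]; simp
  rw [hx] at hlim
  refine mem_closure_of_tendsto hlim ?_
  filter_upwards [eventually_gt_atTop 0] with n hn
  have h := integral_comp_mul_left_Ioi (fun s => laplaceWeight 0 n s • T s x) 0 (inv_pos.2 hn)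
  have e : ∀ u : ℝ, laplaceWeight 0 n (n⁻¹ * u) = laplaceWeight 0 1 u := fun u => by
    have : (n : ℂ) ≠ 0 := by exact_mod_cast hn.ne'
    simp [laplaceWeight, this]
  simp only [e, mul_zero] at h
  rw [h, hT.integral_laplaceWeight_zero_smul hA hR (by simpa using hn), inv_inv,
    ← Complex.coe_smul]
  exact hA.domain.smul_mem _ (hR.mem_dom _ (by simpa using hn) x)

/-- The orbit of `x` weighted by `sⁿ e^{-ωs}` and extended by zero to the negative half-line. -/
noncomputable def weightedOrbit (T : ℝ → X →L[ℂ] X) (n : ℕ) (ω : ℝ) (x : X) : ℝ → X :=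
  (Ioi 0).indicator fun s => laplaceWeight n ω s • T s x

theorem integrable_weightedOrbit (hT : IsBoundedC0Semigroup T c) (n : ℕ) {ω : ℝ} (hω : 0 < ω)
    (x : X) : Integrable (weightedOrbit T n ω x) :=
  (integrable_indicator_iff measurableSet_Ioi).2
    (hT.integrableOn_laplaceWeight_smul n (by simpa using hω) x)

theorem norm_laplaceWeight_smul_sq_le (hT : IsBoundedC0Semigroup T c) (n : ℕ) (ω : ℝ) (x : X)
    {s : ℝ} (hs : 0 ≤ s) : ‖laplaceWeight n ω s • T s x‖ ^ 2 ≤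
      (c * ‖x‖) ^ 2 * (s ^ (2 * n) * Real.exp (-(2 * ω) * s)) := by
  have h : ‖laplaceWeight n ω s • T s x‖ ≤ (s ^ n * Real.exp (-ω * s)) * (c * ‖x‖) := by
    rw [norm_smul, norm_laplaceWeight n ω hs, Complex.ofReal_re]
    gcongr
    exact hT.norm_apply_le hs x
  calc _ ≤ ((s ^ n * Real.exp (-ω * s)) * (c * ‖x‖)) ^ 2 := by gcongr
    _ = (c * ‖x‖) ^ 2 * (s ^ (2 * n) * Real.exp (-(2 * ω) * s)) := by
      rw [show -(2 * ω) * s = -ω * s + -ω * s by ring, Real.exp_add]; ring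

theorem integral_norm_weightedOrbit_sq (n : ℕ) (ω : ℝ) (x : X) :
    ∫ s, ‖weightedOrbit T n ω x s‖ ^ 2 = ∫ s in Ioi 0, ‖laplaceWeight n ω s • T s x‖ ^ 2 := by
  rw [← integral_indicator measurableSet_Ioi]
  congr 1
  ext s
  by_cases hs : s ∈ Ioi (0 : ℝ) <;> simp [weightedOrbit, hs]

theorem integrableOn_norm_laplaceWeight_smul_sq (hT : IsBoundedC0Semigroup T c) (n : ℕ) {ω : ℝ}
    (hω : 0 < ω) (x : X) :
    IntegrableOn (fun s => ‖laplaceWeight n ω s • T s x‖ ^ 2) (Ioi 0) := by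
  refine ((integrableOn_pow_mul_exp_neg_mul_Ioi (2 * n)
    (mul_pos two_pos hω)).const_mul ((c * ‖x‖) ^ 2)).mono' ?_ ?_
  · exact (hT.integrableOn_laplaceWeight_smul n
      (by simpa using hω) x).aestronglyMeasurable.norm.pow 2
  · filter_upwards [ae_restrict_mem measurableSet_Ioi] with s hs
    rw [Real.norm_of_nonneg (by positivity)]
    exact hT.norm_laplaceWeight_smul_sq_le n ω x (le_of_lt hs)

theorem memLp_weightedOrbit (hT : IsBoundedC0Semigroup T c) (n : ℕ) {ω : ℝ} (hω : 0 < ω)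
    (x : X) : MemLp (weightedOrbit T n ω x) 2 := by
  rw [weightedOrbit, memLp_indicator_iff_restrict measurableSet_Ioi,
    memLp_two_iff_integrable_sq_norm
      (hT.integrableOn_laplaceWeight_smul n (by simpa using hω) x).aestronglyMeasurable]
  exact hT.integrableOn_norm_laplaceWeight_smul_sq n hω x

theorem integral_norm_weightedOrbit_zero_sq_le (hT : IsBoundedC0Semigroup T c) {ω : ℝ}
    (hω : 0 < ω) (x : X) :
    ∫ s, ‖weightedOrbit T 0 ω x s‖ ^ 2 ≤ (c * ‖x‖) ^ 2 / (2 * ω) := by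
  rw [integral_norm_weightedOrbit_sq]
  have h2 : 0 < 2 * ω := by positivity
  calc ∫ s in Ioi 0, ‖laplaceWeight 0 ω s • T s x‖ ^ 2
      ≤ ∫ s in Ioi 0, (c * ‖x‖) ^ 2 * (s ^ (2 * 0) * Real.exp (-(2 * ω) * s)) :=
        setIntegral_mono_on (hT.integrableOn_norm_laplaceWeight_smul_sq 0 hω x)
          ((integrableOn_pow_mul_exp_neg_mul_Ioi _ h2).const_mul _) measurableSet_Ioi
          fun s hs => hT.norm_laplaceWeight_smul_sq_le 0 ω x (le_of_lt hs)
    _ = (c * ‖x‖) ^ 2 / (2 * ω) := by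
      rw [integral_const_mul]
      simp only [mul_zero, pow_zero, one_mul]
      rw [integral_exp_mul_Ioi (by linarith)]
      simp [div_eq_mul_inv]

theorem le_integral_norm_weightedOrbit_one_sq (hT : IsBoundedC0Semigroup T c) {t : ℝ}
    (ht : 0 < t) {x : X} {k : ℝ} (hk : 0 ≤ k) (hx : ∀ s ∈ Ioc 0 t, k ≤ ‖T s x‖) :
    k ^ 2 * Real.exp (-2) * (t ^ 3 / 3) ≤ ∫ s, ‖weightedOrbit T 1 (1 / t) x s‖ ^ 2 := by
  have hint := hT.integrableOn_norm_laplaceWeight_smul_sq 1 (one_div_pos.2 ht) x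
  rw [integral_norm_weightedOrbit_sq]
  calc k ^ 2 * Real.exp (-2) * (t ^ 3 / 3)
      = ∫ s in Ioc 0 t, k ^ 2 * Real.exp (-2) * s ^ 2 := by
        rw [← intervalIntegral.integral_of_le ht.le, intervalIntegral.integral_const_mul,
          integral_pow]
        norm_num
    _ ≤ ∫ s in Ioc 0 t, ‖laplaceWeight 1 ↑(1 / t) s • T s x‖ ^ 2 := by
        refine setIntegral_mono_on ?_ (hint.mono_set Ioc_subset_Ioi_self) measurableSet_Ioc
          fun s hs => ?_
        · exact (Continuous.integrableOn_Icc (by fun_prop)).mono_set Ioc_subset_Icc_self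
        · have h1 : Real.exp (-1) ≤ Real.exp (-(1 / t) * s) := by
            rw [Real.exp_le_exp, neg_mul, neg_le_neg_iff, one_div, inv_mul_le_one₀ ht]
            exact hs.2
          have h2 : s * Real.exp (-1) * k ≤ ‖laplaceWeight 1 ↑(1 / t) s • T s x‖ := by
            rw [norm_smul, norm_laplaceWeight 1 _ hs.1.le, Complex.ofReal_re, pow_one]
            have := hs.1.le
            gcongr
            exact hx s hs
          calc _ = (s * Real.exp (-1) * k) ^ 2 := by
                rw [show (-2 : ℝ) = -1 + -1 by norm_num, Real.exp_add]; ring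
            _ ≤ _ := by
                have := hs.1.le
                gcongr
    _ ≤ ∫ s in Ioi 0, ‖laplaceWeight 1 ↑(1 / t) s • T s x‖ ^ 2 :=
        setIntegral_mono_set hint (ae_of_all _ fun s => by positivity)
          (ae_of_all _ Ioc_subset_Ioi_self)

theorem fourier_weightedOrbit (n : ℕ) (ω : ℝ) (x : X) (η : ℝ) :
    𝓕 (weightedOrbit T n ω x) η =
      ∫ s in Ioi 0, laplaceWeight n (ω + 2 * Real.pi * η * Complex.I) s • T s x := by
  rw [Real.fourier_real_eq_integral_exp_smul, ← integral_indicator measurableSet_Ioi]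
  congr 1
  ext s
  by_cases hs : s ∈ Ioi (0 : ℝ)
  · simp only [weightedOrbit, hs, indicator_of_mem, laplaceWeight, smul_smul]
    congr 1
    rw [mul_left_comm, ← Complex.exp_add]
    congr 2
    push_cast
    ring
  · simp [weightedOrbit, hs]

end IsBoundedC0Semigroup

namespace IsBoundedC0Semigroup

variable {X : Type*} [NormedAddCommGroup X] [InnerProductSpace ℂ X] [CompleteSpace X]
  {T : ℝ → X →L[ℂ] X} {c : ℝ} {Dom : Set X} {A C : X → X} {R : ℂ → X →L[ℂ] X}

/-- A linear map on the domain of the generator that commutes with the semigroup and is bounded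
after composition with the resolvent commutes with the resolvent. -/
theorem resolvent_comm_of_comm (hT : IsBoundedC0Semigroup T c)
    (hA : IsGeneratorOf Dom A T) (hR : IsResolventOf R Dom A)
    (hCadd : ∀ x ∈ Dom, ∀ y ∈ Dom, C (x + y) = C x + C y)
    (hCsmul : ∀ (a : ℂ), ∀ x ∈ Dom, C (a • x) = a • C x)
    (hcomm : ∀ t : ℝ, 0 ≤ t → ∀ x ∈ Dom, T t (C x) = C (T t x))
    {lam : ℂ} (hlam : 0 < lam.re) {K : ℝ} (hK : ∀ x : X, ‖C (R lam x)‖ ≤ K * ‖x‖)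
    {x : X} (hx : x ∈ Dom) : R lam (C x) = C (R lam x) := by
  have hmem := hR.mem_dom lam hlam
  let B : X →L[ℂ] X := LinearMap.mkContinuous
    { toFun := fun x => C (R lam x)
      map_add' := fun x y => by rw [map_add, hCadd _ (hmem x) _ (hmem y)]
      map_smul' := fun a x => by rw [map_smul, hCsmul _ _ (hmem x)]; rfl } K hK
  have h := hT.commute_resolvent hA hR hlam B (fun s hs y => ?_) (lam • x - A x)
  · change R lam (C (R lam (lam • x - A x))) = C (R lam (R lam (lam • x - A x))) at h
    rwa [hR.apply_sub lam hlam x hx] at h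
  · change T s (C (R lam y)) = C (R lam (T s y))
    rw [hcomm s hs _ (hmem y), hT.apply_resolvent hA hR hlam hs]

theorem norm_apply_comp_le_of_resolvent_bound (hT : IsBoundedC0Semigroup T c) (hc : 0 < c)
    (hA : IsGeneratorOf Dom A T) (hR : IsResolventOf R Dom A)
    (hCadd : ∀ x ∈ Dom, ∀ y ∈ Dom, C (x + y) = C x + C y)
    (hCsmul : ∀ (a : ℂ), ∀ x ∈ Dom, C (a • x) = a • C x)
    (hcomm : ∀ t : ℝ, 0 ≤ t → ∀ x ∈ Dom, T t (C x) = C (T t x))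
    {t : ℝ} (ht : 0 < t) {K : ℝ} (hK0 : 0 ≤ K)
    (hK : ∀ lam : ℂ, lam.re = 1 / t → ∀ x : X, ‖C (R lam x)‖ ≤ K * ‖x‖)
    {x : X} (hx : x ∈ Dom) :
    ‖C (T t x)‖ ≤ 2 * Real.exp 1 * c ^ 2 * (K / t) * ‖x‖ := by
  have hω : 0 < 1 / t := one_div_pos.2 ht
  have hlow : ∀ s ∈ Ioc 0 t, ‖C (T t x)‖ / c ≤ ‖T s (C x)‖ := by
    intro s hs
    rw [div_le_iff₀' hc, ← hcomm t ht.le x hx, ← sub_add_cancel t s,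
      hT.apply_add (sub_nonneg.2 hs.2) hs.1.le]
    exact hT.norm_apply_le (sub_nonneg.2 hs.2) _
  have h1 := hT.le_integral_norm_weightedOrbit_one_sq ht (by positivity) hlow
  have h2 := hT.integral_norm_weightedOrbit_zero_sq_le hω x
  obtain ⟨hm0, hP0⟩ := memLp_fourier_and_integral_norm_sq_fourier
    (hT.integrable_weightedOrbit 0 hω x) (hT.memLp_weightedOrbit 0 hω x)
  obtain ⟨hm1, hP1⟩ := memLp_fourier_and_integral_norm_sq_fourier
    (hT.integrable_weightedOrbit 1 hω (C x)) (hT.memLp_weightedOrbit 1 hω (C x))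
  have hpt : ∀ η, ‖𝓕 (weightedOrbit T 1 (1 / t) (C x)) η‖ ^ 2 ≤
      K ^ 2 * ‖𝓕 (weightedOrbit T 0 (1 / t) x) η‖ ^ 2 := by
    intro η
    rw [fourier_weightedOrbit, fourier_weightedOrbit, ← mul_pow]
    set lam : ℂ := ((1 / t : ℝ) : ℂ) + 2 * Real.pi * η * Complex.I with hlam_def
    have hre : lam.re = 1 / t := by simp [hlam_def]
    have hlam : 0 < lam.re := hre ▸ hω
    have hcommR {y : X} (hy : y ∈ Dom) : R lam (C y) = C (R lam y) :=
      hT.resolvent_comm_of_comm hA hR hCadd hCsmul hcomm hlam (hK lam hre) hy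
    rw [hT.integral_laplaceWeight_one_smul hA hR hlam,
      hT.integral_laplaceWeight_zero_smul hA hR hlam, hcommR hx,
      hcommR (hR.mem_dom lam hlam x)]
    gcongr
    exact hK lam hre _
  have h3 : ∫ s, ‖weightedOrbit T 1 (1 / t) (C x) s‖ ^ 2 ≤
      K ^ 2 * ∫ s, ‖weightedOrbit T 0 (1 / t) x s‖ ^ 2 := by
    rw [← hP0, ← hP1, ← integral_const_mul]
    exact integral_mono (hm1.integrable_norm_pow two_ne_zero)
      ((hm0.integrable_norm_pow two_ne_zero).const_mul _) hpt
  have h4 := (h1.trans h3).trans (mul_le_mul_of_nonneg_left h2 (sq_nonneg K))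
  have h5 : ‖C (T t x)‖ ^ 2 ≤ 3 / 2 * (Real.exp 1 * c ^ 2 * (K / t) * ‖x‖) ^ 2 := by
    have he : Real.exp (-2) = (Real.exp 1 ^ 2)⁻¹ := by
      rw [← Real.exp_nat_mul, ← Real.exp_neg]; norm_num
    rw [he] at h4
    calc ‖C (T t x)‖ ^ 2
        = (‖C (T t x)‖ / c) ^ 2 * (Real.exp 1 ^ 2)⁻¹ * (t ^ 3 / 3) *
            (3 * c ^ 2 * Real.exp 1 ^ 2 / t ^ 3) := by field_simp
      _ ≤ K ^ 2 * ((c * ‖x‖) ^ 2 / (2 * (1 / t))) * (3 * c ^ 2 * Real.exp 1 ^ 2 / t ^ 3) := by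
          gcongr
      _ = 3 / 2 * (Real.exp 1 * c ^ 2 * (K / t) * ‖x‖) ^ 2 := by field_simp
  refine (sq_le_sq₀ (norm_nonneg _) (by positivity)).1 (h5.trans ?_)
  nlinarith [sq_nonneg (Real.exp 1 * c ^ 2 * (K / t) * ‖x‖)]

end IsBoundedC0Semigroup


/-- Transference from a resolvent bound `‖C R(λ,A)x‖ ≤ F(Re λ)‖x‖` to the
semigroup bound `‖C T(t)x‖ ≤ M (F(1/t)/t) ‖x‖`, for a bounded C₀-semigroup on a Hilbert
space and a relatively `A`-bounded `C` commuting with the semigroup; in particular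
`C T(t)` extends to a bounded operator of norm at most `M F(1/t)/t`. -/
theorem stmt_5
    {X : Type*} [NormedAddCommGroup X] [InnerProductSpace ℂ X] [CompleteSpace X]
    (T : ℝ → X →L[ℂ] X)
    (hT0 : T 0 = 1)
    (hTsemi : ∀ s t : ℝ, 0 ≤ s → 0 ≤ t → T (s + t) = T s ∘L T t)
    (hTcont : ∀ x : X, ContinuousOn (fun t : ℝ => T t x) (Set.Ici 0))
    (hTbdd : ∃ c : ℝ, ∀ t : ℝ, 0 ≤ t → ‖T t‖ ≤ c)
    (Dom : Set X) (A : X → X)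
    (hgen : ∀ x y, (x ∈ Dom ∧ A x = y) ↔
      Filter.Tendsto (fun t : ℝ => (t : ℂ)⁻¹ • (T t x - x))
        (nhdsWithin 0 (Set.Ioi 0)) (nhds y))
    (R : ℂ → X →L[ℂ] X)
    (hR₁ : ∀ lam : ℂ, 0 < lam.re → ∀ x, R lam x ∈ Dom ∧ lam • R lam x - A (R lam x) = x)
    (hR₂ : ∀ lam : ℂ, 0 < lam.re → ∀ x ∈ Dom, R lam (lam • x - A x) = x)
    (C : X → X)
    (hCadd : ∀ x ∈ Dom, ∀ y ∈ Dom, C (x + y) = C x + C y)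
    (hCsmul : ∀ (a : ℂ), ∀ x ∈ Dom, C (a • x) = a • C x)
    (hCbdd : ∃ c₀ > 0, ∀ x ∈ Dom, ‖C x‖ ≤ c₀ * (‖x‖ + ‖A x‖))
    (hcomm : ∀ t : ℝ, 0 ≤ t → ∀ x ∈ Dom, T t (C x) = C (T t x))
    (F : ℝ → ℝ)
    (hFnonneg : ∀ ξ : ℝ, 0 < ξ → 0 ≤ F ξ)
    (hFbound : ∀ lam : ℂ, 0 < lam.re → ∀ x : X, ‖C (R lam x)‖ ≤ F lam.re * ‖x‖) :
    ∃ M > 0,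
      (∀ t : ℝ, 0 < t → ∀ x ∈ Dom, ‖C (T t x)‖ ≤ M * (F (1 / t) / t) * ‖x‖) ∧
      (∀ t : ℝ, 0 < t → ∃ S : X →L[ℂ] X,
        ‖S‖ ≤ M * (F (1 / t) / t) ∧ ∀ x ∈ Dom, S x = C (T t x)) := by
  obtain ⟨c₁, hc₁⟩ := hTbdd
  set c := max c₁ 1
  have hc : 0 < c := one_pos.trans_le (le_max_right _ _)
  have hT : IsBoundedC0Semigroup T c :=
    ⟨hT0, hTsemi, hTcont, fun t ht => (hc₁ t ht).trans (le_max_left _ _)⟩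
  have hA : IsGeneratorOf Dom A T := hgen
  have hR : IsResolventOf R Dom A :=
    ⟨fun lam h x => (hR₁ lam h x).1, fun lam h x => (hR₁ lam h x).2, hR₂⟩
  have hbound : ∀ t : ℝ, 0 < t → ∀ x ∈ Dom,
      ‖C (T t x)‖ ≤ 2 * Real.exp 1 * c ^ 2 * (F (1 / t) / t) * ‖x‖ := by
    intro t ht x hx
    have hω : 0 < 1 / t := one_div_pos.2 ht
    refine hT.norm_apply_comp_le_of_resolvent_bound hc hA hR hCadd hCsmul hcomm ht
      (hFnonneg _ hω) (fun lam hlam x => ?_) hx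
    rw [← hlam]
    exact hFbound lam (hlam ▸ hω) x
  refine ⟨2 * Real.exp 1 * c ^ 2, by positivity, hbound, fun t ht => ?_⟩
  have hmem (x : hA.domain) : T t x ∈ Dom := (hT.apply_mem_dom hA ht.le x.2).1
  let S₀ : hA.domain →ₗ[ℂ] X :=
    { toFun := fun x => C (T t x)
      map_add' := fun x y => by
        rw [Submodule.coe_add, map_add, hCadd _ (hmem x) _ (hmem y)]
      map_smul' := fun a x => by
        rw [Submodule.coe_smul, map_smul, hCsmul _ _ (hmem x)]; rfl }
  have hdense : DenseRange hA.domain.subtype := by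
    rw [DenseRange, Submodule.coe_subtype, Subtype.range_coe]
    exact hT.dense_dom hA hR
  have hS₀ (x : hA.domain) :
      ‖S₀ x‖ ≤ 2 * Real.exp 1 * c ^ 2 * (F (1 / t) / t) * ‖hA.domain.subtype x‖ :=
    hbound t ht x x.2
  have hF := hFnonneg _ (one_div_pos.2 ht)
  exact ⟨S₀.extendOfNorm hA.domain.subtype,
    LinearMap.opNorm_extendOfNorm_le hdense (by positivity) hS₀,
    fun x hx => LinearMap.extendOfNorm_eq hdense ⟨_, hS₀⟩ ⟨x, hx⟩⟩
end

section
/- Let (T(t))_{t≥0} be a C₀-semigroup on a complex Banach space X with generator A, and let C : D(A) → X be a linear map for which there exists c₀ > 0 with ‖Cx‖ ≤ c₀(‖x‖ + ‖Ax‖) for all x ∈ D(A), such that T(t)Cx = C T(t)x for all x ∈ D(A) and all t ≥ 0. Let 1 ≤ p < ∞ and assume C is L^p-infinite-time admissible for A. Then for every t₀ > 0 there exists M > 0 such that ‖C T(t) x‖ ≤ M ‖x‖ for all t ≥ t₀ and all x ∈ D(A); in particular, for each t > 0 the map x ↦ C T(t)x extends to a bounded linear operator on X. -/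
open MeasureTheory Filter Set Topology

section Semigroup

variable {X : Type*} [NormedAddCommGroup X] [NormedSpace ℂ X] {T : ℝ → X →L[ℂ] X}

/-- The domain of the generator of a one-parameter family of operators `T`: the vectors at which
the difference quotients of the orbit converge as `t` decreases to `0`. -/
def generatorDomain (T : ℝ → X →L[ℂ] X) : Submodule ℂ X where
  carrier := {x | ∃ y, Tendsto (fun t : ℝ => (t : ℂ)⁻¹ • (T t x - x)) (𝓝[>] 0) (𝓝 y)}
  add_mem' := by
    rintro x x' ⟨y, hy⟩ ⟨y', hy'⟩
    refine ⟨y + y', (hy.add hy').congr fun t => ?_⟩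
    rw [← smul_add, map_add]
    congr 1
    abel
  zero_mem' := ⟨0, by simp⟩
  smul_mem' := by
    rintro a x ⟨y, hy⟩
    refine ⟨a • y, (hy.const_smul a).congr fun t => ?_⟩
    rw [smul_comm, smul_sub, map_smul]

theorem map_mem_generatorDomain (hTsemi : ∀ s t : ℝ, 0 ≤ s → 0 ≤ t → T (s + t) = T s ∘L T t)
    {t : ℝ} (ht : 0 ≤ t) {x : X} (hx : x ∈ generatorDomain T) : T t x ∈ generatorDomain T := by
  obtain ⟨y, hy⟩ := hx
  refine ⟨T t y, (((T t).continuous.tendsto y).comp hy).congr' ?_⟩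
  filter_upwards [self_mem_nhdsWithin] with s (hs : 0 < s)
  have h : T s (T t x) = T t (T s x) := by
    rw [← ContinuousLinearMap.comp_apply, ← hTsemi s t hs.le ht, add_comm, hTsemi t s ht hs.le,
      ContinuousLinearMap.comp_apply]
  simp [h]

theorem exists_norm_le_of_mem_Icc [CompleteSpace X]
    (hTcont : ∀ x : X, ContinuousOn (fun t : ℝ => T t x) (Ici 0)) (t₀ : ℝ) :
    ∃ N > 0, ∀ s ∈ Icc 0 t₀, ‖T s‖ ≤ N := by
  obtain ⟨N, hN⟩ := banach_steinhaus (g := fun s : Icc 0 t₀ => T s) fun x => by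
    obtain ⟨K, hK⟩ := isCompact_Icc.exists_bound_of_continuousOn
      ((hTcont x).mono (Icc_subset_Ici_self : Icc 0 t₀ ⊆ Ici 0))
    exact ⟨K, fun s => hK s s.2⟩
  exact ⟨max N 1, by positivity, fun s hs => (hN ⟨s, hs⟩).trans (le_max_left _ _)⟩

theorem dense_generatorDomain [CompleteSpace X] (hT0 : T 0 = 1)
    (hTsemi : ∀ s t : ℝ, 0 ≤ s → 0 ≤ t → T (s + t) = T s ∘L T t)
    (hTcont : ∀ x : X, ContinuousOn (fun t : ℝ => T t x) (Ici 0)) :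
    Dense (generatorDomain T : Set X) := by
  intro x
  set u : ℝ → X := fun t => T (max t 0) x with hu
  have hucont : Continuous u :=
    (hTcont x).comp_continuous (continuous_id.max continuous_const) fun t => le_max_right t 0
  set F : ℝ → X := fun h => ∫ s in (0 : ℝ)..h, u s
  have hF : ∀ h, HasDerivAt F (u h) h := fun h =>
    (hucont.integral_hasStrictDerivAt 0 h).hasDerivAt
  have hF0 : F 0 = 0 := intervalIntegral.integral_same
  have hint : ∀ a b, IntervalIntegrable u volume a b := fun a b => hucont.intervalIntegrable a b
  have hshift : ∀ ε h, 0 ≤ ε → 0 ≤ h → T ε (F h) = F (h + ε) - F ε := by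
    intro ε h hε hh
    rw [← ContinuousLinearMap.intervalIntegral_comp_comm _ (hint 0 h)]
    have : ∫ s in (0 : ℝ)..h, T ε (u s) = ∫ s in (0 : ℝ)..h, u (s + ε) := by
      refine intervalIntegral.integral_congr fun s hs => ?_
      rw [uIcc_of_le hh] at hs
      simp only [hu]
      rw [max_eq_left hs.1, max_eq_left (add_nonneg hs.1 hε), add_comm, hTsemi ε s hε hs.1,
        ContinuousLinearMap.comp_apply]
    rw [this, intervalIntegral.integral_comp_add_right, zero_add, eq_sub_iff_add_eq, add_comm]
    exact intervalIntegral.integral_add_adjacent_intervals (hint _ _) (hint _ _)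
  have hmem : ∀ h, 0 ≤ h → F h ∈ generatorDomain T := by
    intro h hh
    refine ⟨u h - u 0,
      ((hF h).tendsto_slope_zero_right.sub (hF 0).tendsto_slope_zero_right).congr' ?_⟩
    filter_upwards [self_mem_nhdsWithin] with ε (hε : 0 < ε)
    rw [hshift ε h hε.le hh, ← Complex.ofReal_inv, Complex.coe_smul, ← smul_sub, hF0, zero_add]
    congr 1
    abel
  have hlim : Tendsto (fun h : ℝ => h⁻¹ • F h) (𝓝[>] 0) (𝓝 x) := by
    simpa [hF0, hu, hT0] using (hF 0).tendsto_slope_zero_right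
  refine mem_closure_of_tendsto hlim ?_
  filter_upwards [self_mem_nhdsWithin] with h (hh : 0 < h)
  rw [← Complex.coe_smul]
  exact (generatorDomain T).smul_mem _ (hmem h hh.le)

end Semigroup

theorem le_mul_rpow_of_lintegral_rpow_le {g : ℝ → ℝ} {k N B p t₀ t : ℝ} (hp : 0 < p)
    (hN : 0 < N) (hk : 0 ≤ k) (hB : 0 ≤ B) (ht₀ : 0 < t₀) (ht : t₀ ≤ t)
    (hg : ∀ r ∈ Ioc (t - t₀) t, k ≤ N * g r)
    (hint : ∫⁻ r in Ioi (0 : ℝ), ENNReal.ofReal (g r ^ p) ≤ ENNReal.ofReal B) :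
    k ≤ N * (B / t₀) ^ p⁻¹ := by
  have h : ENNReal.ofReal ((k / N) ^ p * t₀) ≤ ENNReal.ofReal B := calc
    ENNReal.ofReal ((k / N) ^ p * t₀)
      = ∫⁻ _ in Ioc (t - t₀) t, ENNReal.ofReal ((k / N) ^ p) := by
        rw [setLIntegral_const, Real.volume_Ioc, sub_sub_cancel,
          ENNReal.ofReal_mul (by positivity)]
    _ ≤ ∫⁻ r in Ioc (t - t₀) t, ENNReal.ofReal (g r ^ p) := by
        refine setLIntegral_mono' measurableSet_Ioc fun r hr => ENNReal.ofReal_le_ofReal ?_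
        exact Real.rpow_le_rpow (by positivity) ((div_le_iff₀' hN).2 (hg r hr)) hp.le
    _ ≤ ∫⁻ r in Ioi (0 : ℝ), ENNReal.ofReal (g r ^ p) :=
        lintegral_mono_set fun r hr => (sub_nonneg.2 ht).trans_lt hr.1
    _ ≤ ENNReal.ofReal B := hint
  rw [ENNReal.ofReal_le_ofReal_iff hB, ← le_div_iff₀ ht₀] at h
  rw [← div_le_iff₀' hN]
  exact (Real.le_rpow_inv_iff_of_pos (by positivity) (by positivity) hp).2 h

/-- If `C` (relatively `A`-bounded, commuting with the semigroup) is
`L^p`-infinite-time admissible for the generator `A` of a (not necessarily bounded)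
C₀-semigroup on a Banach space, then for every `t₀ > 0` the operators `C T(t)` are
uniformly bounded for `t ≥ t₀`; in particular each `C T(t)`, `t > 0`, extends to a
bounded operator on `X`. -/
theorem stmt_6
    {X : Type*} [NormedAddCommGroup X] [NormedSpace ℂ X] [CompleteSpace X]
    (T : ℝ → X →L[ℂ] X)
    (hT0 : T 0 = 1)
    (hTsemi : ∀ s t : ℝ, 0 ≤ s → 0 ≤ t → T (s + t) = T s ∘L T t)
    (hTcont : ∀ x : X, ContinuousOn (fun t : ℝ => T t x) (Set.Ici 0))
    (Dom : Set X) (A : X → X)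
    (hgen : ∀ x y, (x ∈ Dom ∧ A x = y) ↔
      Filter.Tendsto (fun t : ℝ => (t : ℂ)⁻¹ • (T t x - x))
        (nhdsWithin 0 (Set.Ioi 0)) (nhds y))
    (C : X → X)
    (hCadd : ∀ x ∈ Dom, ∀ y ∈ Dom, C (x + y) = C x + C y)
    (hCsmul : ∀ (a : ℂ), ∀ x ∈ Dom, C (a • x) = a • C x)
    (hCbdd : ∃ c₀ > 0, ∀ x ∈ Dom, ‖C x‖ ≤ c₀ * (‖x‖ + ‖A x‖))
    (hcomm : ∀ t : ℝ, 0 ≤ t → ∀ x ∈ Dom, T t (C x) = C (T t x))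
    (p : ℝ) (hp : 1 ≤ p)
    (hadm : ∃ M₀ > 0, ∀ x ∈ Dom,
      ∫⁻ t in Set.Ioi (0 : ℝ), ENNReal.ofReal (‖C (T t x)‖ ^ p)
        ≤ ENNReal.ofReal (M₀ * ‖x‖ ^ p)) :
    (∀ t₀ : ℝ, 0 < t₀ → ∃ M > 0, ∀ t : ℝ, t₀ ≤ t → ∀ x ∈ Dom, ‖C (T t x)‖ ≤ M * ‖x‖) ∧
    (∀ t : ℝ, 0 < t → ∃ S : X →L[ℂ] X, ∀ x ∈ Dom, S x = C (T t x)) := by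
  have hDom : Dom = generatorDomain T := by
    ext x
    exact ⟨fun hx => ⟨A x, (hgen x _).1 ⟨hx, rfl⟩⟩, fun ⟨y, hy⟩ => ((hgen x y).2 hy).1⟩
  have hp0 : 0 < p := one_pos.trans_le hp
  have hTDom : ∀ {t : ℝ}, 0 ≤ t → ∀ {x : X}, x ∈ Dom → T t x ∈ Dom := by
    rw [hDom]
    exact fun ht _ hx => map_mem_generatorDomain hTsemi ht hx
  have hbound : ∀ t₀ : ℝ, 0 < t₀ →
      ∃ M > 0, ∀ t : ℝ, t₀ ≤ t → ∀ x ∈ Dom, ‖C (T t x)‖ ≤ M * ‖x‖ := by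
    intro t₀ ht₀
    obtain ⟨M₀, hM₀, hadm⟩ := hadm
    obtain ⟨N, hN, hTN⟩ := exists_norm_le_of_mem_Icc hTcont t₀
    refine ⟨N * (M₀ / t₀) ^ p⁻¹, by positivity, fun t ht x hx => ?_⟩
    have hle : ∀ r ∈ Ioc (t - t₀) t, ‖C (T t x)‖ ≤ N * ‖C (T r x)‖ := by
      intro r hr
      have hr0 : 0 ≤ r := (sub_nonneg.2 ht).trans hr.1.le
      have hs : 0 ≤ t - r := sub_nonneg.2 hr.2
      have hcomp : C (T t x) = T (t - r) (C (T r x)) := by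
        rw [hcomm _ hs _ (hTDom hr0 hx), ← ContinuousLinearMap.comp_apply, ← hTsemi _ _ hs hr0,
          sub_add_cancel]
      rw [hcomp]
      exact (T (t - r)).le_of_opNorm_le (hTN _ ⟨hs, by linarith [hr.1]⟩) _
    have h := le_mul_rpow_of_lintegral_rpow_le hp0 hN (norm_nonneg _) (by positivity) ht₀ ht hle
      (hadm x hx)
    rwa [mul_div_right_comm, Real.mul_rpow (by positivity) (by positivity),
      Real.rpow_rpow_inv (norm_nonneg x) hp0.ne', ← mul_assoc] at h
  refine ⟨hbound, fun t ht => ?_⟩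
  obtain ⟨M, -, hM⟩ := hbound t ht
  subst hDom
  let f : generatorDomain T →ₗ[ℂ] X :=
    { toFun := fun x => C (T t x)
      map_add' := fun x y => by
        rw [Submodule.coe_add, map_add, hCadd _ (hTDom ht.le x.2) _ (hTDom ht.le y.2)]
      map_smul' := fun a x => by
        rw [Submodule.coe_smul, map_smul, hCsmul _ _ (hTDom ht.le x.2), RingHom.id_apply] }
  have hdense : DenseRange (generatorDomain T).subtype := by
    simpa [DenseRange] using dense_generatorDomain hT0 hTsemi hTcont
  exact ⟨f.extendOfNorm (generatorDomain T).subtype, fun x hx =>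
    LinearMap.extendOfNorm_eq hdense ⟨M, fun y => hM t le_rfl y y.2⟩ ⟨x, hx⟩⟩
end

section
/- Let (T(t))_{t≥0} be a bounded C₀-semigroup on a complex Banach space X with generator A such that 0 lies in the resolvent set of A (so A⁻¹ is bounded). Fix an integer n ≥ 1 and a real number p with 1 ≤ p < ∞. If the bounded operator A^{-n} := (A⁻¹)ⁿ is L^p-infinite-time admissible for A, i.e., there exists M > 0 with ∫₀^∞ ‖A^{-n} T(t) x‖^p dt ≤ M ‖x‖^p for all x ∈ X, then there exist M', t₁ > 0 such that ‖T(t) A⁻¹‖ ≤ M' t^{-1/(np)} for all t ≥ t₁. (Integer-exponent case α = np of the implication from admissibility of (−A)^{-α/p} to polynomial decay.) -/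
open MeasureTheory

section Semigroup

variable {X : Type*} [NormedAddCommGroup X] [NormedSpace ℂ X]

/-- The orbit of a point `x` at which the semigroup is right differentiable at `0`, with
derivative `y`, is right differentiable at every `s ≥ 0`, with derivative `T s y`. -/
theorem hasDerivWithinAt_orbit {T : ℝ → X →L[ℂ] X}
    (hTsemi : ∀ s t : ℝ, 0 ≤ s → 0 ≤ t → T (s + t) = T s ∘L T t) {x y : X}
    (h : Filter.Tendsto (fun t : ℝ => (t : ℂ)⁻¹ • (T t x - x))
      (nhdsWithin 0 (Set.Ioi 0)) (nhds y)) {s : ℝ} (hs : 0 ≤ s) :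
    HasDerivWithinAt (fun t => T t x) (T s y) (Set.Ici s) s := by
  rw [← hasDerivWithinAt_Ioi_iff_Ici, hasDerivWithinAt_iff_tendsto_slope' (by simp)]
  have hshift : Filter.Tendsto (fun t : ℝ => t - s) (nhdsWithin s (Set.Ioi s))
      (nhdsWithin 0 (Set.Ioi 0)) := by
    refine tendsto_nhdsWithin_of_tendsto_nhds_of_eventually_within _ ?_ ?_
    · have : Filter.Tendsto (fun t : ℝ => t - s) (nhds s) (nhds (s - s)) :=
        (continuous_id.sub continuous_const).tendsto s
      rw [sub_self] at this
      exact this.mono_left nhdsWithin_le_nhds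
    · filter_upwards [self_mem_nhdsWithin] with t ht
      exact sub_pos.2 (Set.mem_Ioi.1 ht)
  refine (((T s).continuous.tendsto y).comp (h.comp hshift)).congr' ?_
  filter_upwards [self_mem_nhdsWithin] with t ht
  have hts : T t = T s ∘L T (t - s) := by
    rw [← hTsemi s (t - s) hs (sub_nonneg.2 (le_of_lt ht)), add_sub_cancel]
  simp only [Function.comp_apply, slope_def_module, map_smul, map_sub, hts,
    ContinuousLinearMap.comp_apply]
  rw [← Complex.ofReal_inv, Complex.coe_smul]

/-- A semigroup commutes with a bounded inverse of its generator. -/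
theorem inverse_generator_comm {T : ℝ → X →L[ℂ] X}
    (hTsemi : ∀ s t : ℝ, 0 ≤ s → 0 ≤ t → T (s + t) = T s ∘L T t)
    {Dom : Set X} {A : X → X}
    (hgen : ∀ x y, (x ∈ Dom ∧ A x = y) ↔
      Filter.Tendsto (fun t : ℝ => (t : ℂ)⁻¹ • (T t x - x))
        (nhdsWithin 0 (Set.Ioi 0)) (nhds y))
    {Ainv : X →L[ℂ] X}
    (hAinv₁ : ∀ x, Ainv x ∈ Dom ∧ A (Ainv x) = x)
    (hAinv₂ : ∀ x ∈ Dom, Ainv (A x) = x) {s : ℝ} (hs : 0 ≤ s) :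
    Commute Ainv (T s) := by
  ext x
  have hlim := (hgen _ _).1 (hAinv₁ x)
  have hT : T s (Ainv x) ∈ Dom ∧ A (T s (Ainv x)) = T s x := by
    refine (hgen _ _).2 ((((T s).continuous.tendsto x).comp hlim).congr' ?_)
    filter_upwards [self_mem_nhdsWithin] with t ht
    have hts : T t (T s (Ainv x)) = T s (T t (Ainv x)) := by
      have h := (hTsemi t s (le_of_lt ht) hs).symm.trans
        ((congrArg T (add_comm t s)).trans (hTsemi s t hs (le_of_lt ht)))
      exact congrArg (fun L : X →L[ℂ] X => L (Ainv x)) h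
    simp [hts]
  have := hAinv₂ _ hT.1
  rw [hT.2] at this
  simpa using this

/-- Landau's inequality `‖A y‖² ≤ C ‖A² y‖ ‖y‖` for a bounded semigroup, written in terms of
`z = A² y`. -/
theorem landau_inequality {T : ℝ → X →L[ℂ] X} (hT0 : T 0 = 1)
    (hTsemi : ∀ s t : ℝ, 0 ≤ s → 0 ≤ t → T (s + t) = T s ∘L T t)
    (hTcont : ∀ x : X, ContinuousOn (fun t : ℝ => T t x) (Set.Ici 0))
    {K : ℝ} (hK : ∀ t : ℝ, 0 ≤ t → ‖T t‖ ≤ K) {Ainv : X →L[ℂ] X}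
    (hlim : ∀ x, Filter.Tendsto (fun t : ℝ => (t : ℂ)⁻¹ • (T t (Ainv x) - Ainv x))
      (nhdsWithin 0 (Set.Ioi 0)) (nhds x)) (z : X) :
    ‖Ainv z‖ ^ 2 ≤ 4 * K * (K + 1) * (‖z‖ * ‖Ainv (Ainv z)‖) := by
  have hK0 : 0 ≤ K := (norm_nonneg _).trans (hK 0 le_rfl)
  have hcont : ∀ (x : X) (b : ℝ), ContinuousOn (fun t : ℝ => T t x) (Set.Icc 0 b) :=
    fun x b => (hTcont x).mono Set.Icc_subset_Ici_self
  have hfirst : ∀ s : ℝ, 0 ≤ s → ‖T s (Ainv z) - Ainv z‖ ≤ K * ‖z‖ * s := by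
    intro s hs
    have := norm_image_sub_le_of_norm_deriv_right_le_segment (hcont (Ainv z) s)
      (fun u hu => hasDerivWithinAt_orbit hTsemi (hlim z) hu.1)
      (fun u hu => (T u).le_of_opNorm_le (hK u hu.1) z) s (Set.right_mem_Icc.2 hs)
    simpa [hT0] using this
  have hsecond : ∀ h : ℝ, 0 ≤ h →
      ‖T h (Ainv (Ainv z)) - h • Ainv z - Ainv (Ainv z)‖ ≤ K * ‖z‖ * h * h := by
    intro h hh
    have := norm_image_sub_le_of_norm_deriv_right_le_segment
      (f := fun t => T t (Ainv (Ainv z)) - t • Ainv z)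
      (f' := fun t => T t (Ainv z) - (1 : ℝ) • Ainv z)
      (C := K * ‖z‖ * h)
      ((hcont (Ainv (Ainv z)) h).sub (by fun_prop))
      (fun u hu => (hasDerivWithinAt_orbit hTsemi (hlim _) hu.1).sub
        ((hasDerivWithinAt_id u _).smul_const (Ainv z)))
      (fun u hu => by
        rw [one_smul]
        exact (hfirst u hu.1).trans (by gcongr; exact hu.2.le))
      h (Set.right_mem_Icc.2 hh)
    simpa [hT0] using this
  have hquad : ∀ h : ℝ,
      0 ≤ K * ‖z‖ * (h * h) + (-‖Ainv z‖) * h + (K + 1) * ‖Ainv (Ainv z)‖ := by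
    intro h
    rcases le_total 0 h with hh | hh
    · have h1 : ‖h • Ainv z‖ ≤ K * ‖Ainv (Ainv z)‖ + ‖Ainv (Ainv z)‖ + K * ‖z‖ * h * h := by
        have : h • Ainv z = T h (Ainv (Ainv z)) - Ainv (Ainv z)
            - (T h (Ainv (Ainv z)) - h • Ainv z - Ainv (Ainv z)) := by abel
        rw [this]
        refine norm_sub_le_of_le (norm_sub_le_of_le ?_ le_rfl) (hsecond h hh)
        exact (T h).le_of_opNorm_le (hK h hh) _
      rw [norm_smul, Real.norm_of_nonneg hh] at h1
      linarith
    · have h1 : 0 ≤ (-‖Ainv z‖) * h := mul_nonneg_of_nonpos_of_nonpos (by simp) hh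
      have h2 : 0 ≤ h * h := mul_self_nonneg h
      positivity
  have := discrim_le_zero hquad
  rw [discrim] at this
  nlinarith

/-- If an operator satisfies a Landau inequality, it satisfies the moment inequalities
`‖B z‖ⁿ ≤ C ‖z‖ⁿ⁻¹ ‖Bⁿ z‖`. -/
theorem exists_moment_inequality {B : X →L[ℂ] X} {D : ℝ} (hD : 0 ≤ D)
    (hB : ∀ z, ‖B z‖ ^ 2 ≤ D * (‖z‖ * ‖B (B z)‖)) (m : ℕ) :
    ∃ C, 0 ≤ C ∧ ∀ z, ‖B z‖ ^ (m + 1) ≤ C * ‖z‖ ^ m * ‖(B ^ (m + 1)) z‖ := by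
  induction m with
  | zero => exact ⟨1, zero_le_one, fun z => by simp⟩
  | succ m ih =>
    obtain ⟨C, hC, hCB⟩ := ih
    refine ⟨D ^ (m + 1) * C, by positivity, fun z => ?_⟩
    rcases (norm_nonneg (B z)).eq_or_lt with h0 | h0
    · rw [← h0, zero_pow (by omega)]
      positivity
    have h1 := hCB (B z)
    have h2 : (B ^ (m + 1)) (B z) = (B ^ (m + 1 + 1)) z := by rw [pow_succ B (m + 1)]; rfl
    rw [h2] at h1
    refine le_of_mul_le_mul_right ?_ (pow_pos h0 m)
    calc ‖B z‖ ^ (m + 1 + 1) * ‖B z‖ ^ m = (‖B z‖ ^ 2) ^ (m + 1) := by ring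
      _ ≤ (D * (‖z‖ * ‖B (B z)‖)) ^ (m + 1) := by gcongr; exact hB z
      _ = D ^ (m + 1) * ‖z‖ ^ (m + 1) * ‖B (B z)‖ ^ (m + 1) := by ring
      _ ≤ D ^ (m + 1) * ‖z‖ ^ (m + 1) * (C * ‖B z‖ ^ m * ‖(B ^ (m + 1 + 1)) z‖) := by gcongr
      _ = D ^ (m + 1) * C * ‖z‖ ^ (m + 1) * ‖(B ^ (m + 1 + 1)) z‖ * ‖B z‖ ^ m := by ring

/-- An operator commuting with a bounded semigroup and `L^p`-infinite-time admissible for it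
satisfies `t ‖B T(t) x‖^p ≤ C ‖x‖^p`. -/
theorem mul_rpow_norm_le_of_admissible {T : ℝ → X →L[ℂ] X}
    (hTsemi : ∀ s t : ℝ, 0 ≤ s → 0 ≤ t → T (s + t) = T s ∘L T t)
    {K : ℝ} (hK : ∀ t : ℝ, 0 ≤ t → ‖T t‖ ≤ K) {B : X →L[ℂ] X}
    (hcomm : ∀ t : ℝ, 0 ≤ t → Commute B (T t)) {p M : ℝ} (hp : 0 ≤ p) (hM : 0 ≤ M) {x : X}
    (hadm : ∫⁻ t in Set.Ioi (0 : ℝ), ENNReal.ofReal (‖B (T t x)‖ ^ p)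
        ≤ ENNReal.ofReal (M * ‖x‖ ^ p)) {t : ℝ} (ht : 0 ≤ t) :
    t * ‖B (T t x)‖ ^ p ≤ K ^ p * M * ‖x‖ ^ p := by
  have hK0 : 0 ≤ K := (norm_nonneg _).trans (hK 0 le_rfl)
  have hpt : ∀ s ∈ Set.Ioc 0 t, ENNReal.ofReal (‖B (T t x)‖ ^ p)
      ≤ ENNReal.ofReal (K ^ p) * ENNReal.ofReal (‖B (T s x)‖ ^ p) := by
    intro s hs
    have hts : 0 ≤ t - s := sub_nonneg.2 hs.2
    have heq : B (T t x) = T (t - s) (B (T s x)) := by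
      have h1 : T t = T (t - s) ∘L T s := by rw [← hTsemi _ _ hts hs.1.le, sub_add_cancel]
      have h2 := congrArg (fun L : X →L[ℂ] X => L (T s x)) (hcomm (t - s) hts).eq
      simpa [h1] using h2
    rw [← ENNReal.ofReal_mul (by positivity), ← Real.mul_rpow hK0 (norm_nonneg _), heq]
    gcongr
    exact (T (t - s)).le_of_opNorm_le (hK _ hts) _
  have hint : ENNReal.ofReal (t * ‖B (T t x)‖ ^ p) ≤ ENNReal.ofReal (K ^ p * M * ‖x‖ ^ p) :=
    calc ENNReal.ofReal (t * ‖B (T t x)‖ ^ p)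
        = ∫⁻ _ in Set.Ioc 0 t, ENNReal.ofReal (‖B (T t x)‖ ^ p) := by
          rw [setLIntegral_const, Real.volume_Ioc, sub_zero, ENNReal.ofReal_mul ht, mul_comm]
      _ ≤ ∫⁻ s in Set.Ioc 0 t, ENNReal.ofReal (K ^ p) * ENNReal.ofReal (‖B (T s x)‖ ^ p) :=
          setLIntegral_mono' measurableSet_Ioc hpt
      _ = ENNReal.ofReal (K ^ p) * ∫⁻ s in Set.Ioc 0 t, ENNReal.ofReal (‖B (T s x)‖ ^ p) :=
          lintegral_const_mul' _ _ ENNReal.ofReal_ne_top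
      _ ≤ ENNReal.ofReal (K ^ p) * ENNReal.ofReal (M * ‖x‖ ^ p) := by
          gcongr
          exact (lintegral_mono_set Set.Ioc_subset_Ioi_self).trans hadm
      _ = ENNReal.ofReal (K ^ p * M * ‖x‖ ^ p) := by
          rw [← ENNReal.ofReal_mul (by positivity), mul_assoc]
  exact (ENNReal.ofReal_le_ofReal_iff (by positivity)).1 hint

end Semigroup


/-- For a bounded C₀-semigroup on a Banach space with generator `A` and
`0 ∈ ρ(A)`, if `A^{-n}` is `L^p`-infinite-time admissible for `A`, then
`‖T(t)A⁻¹‖ = O(t^(-1/(np)))` as `t → ∞`. -/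
theorem stmt_8
    {X : Type*} [NormedAddCommGroup X] [NormedSpace ℂ X] [CompleteSpace X]
    (T : ℝ → X →L[ℂ] X)
    (hT0 : T 0 = 1)
    (hTsemi : ∀ s t : ℝ, 0 ≤ s → 0 ≤ t → T (s + t) = T s ∘L T t)
    (hTcont : ∀ x : X, ContinuousOn (fun t : ℝ => T t x) (Set.Ici 0))
    (hTbdd : ∃ c : ℝ, ∀ t : ℝ, 0 ≤ t → ‖T t‖ ≤ c)
    (Dom : Set X) (A : X → X)
    (hgen : ∀ x y, (x ∈ Dom ∧ A x = y) ↔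
      Filter.Tendsto (fun t : ℝ => (t : ℂ)⁻¹ • (T t x - x))
        (nhdsWithin 0 (Set.Ioi 0)) (nhds y))
    (Ainv : X →L[ℂ] X)
    (hAinv₁ : ∀ x, Ainv x ∈ Dom ∧ A (Ainv x) = x)
    (hAinv₂ : ∀ x ∈ Dom, Ainv (A x) = x)
    (n : ℕ) (hn : 1 ≤ n) (p : ℝ) (hp : 1 ≤ p)
    (hadm : ∃ M > 0, ∀ x : X,
      ∫⁻ t in Set.Ioi (0 : ℝ), ENNReal.ofReal (‖(Ainv ^ n) (T t x)‖ ^ p)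
        ≤ ENNReal.ofReal (M * ‖x‖ ^ p)) :
    ∃ M' > 0, ∃ t₁ > 0, ∀ t : ℝ, t₁ ≤ t →
      ‖(T t) ∘L Ainv‖ ≤ M' * t ^ (-(1 / ((n : ℝ) * p))) := by
  obtain ⟨K, hK⟩ := hTbdd
  obtain ⟨M, hM, hadm⟩ := hadm
  have hK0 : 0 ≤ K := (norm_nonneg _).trans (hK 0 le_rfl)
  have hp0 : 0 < p := by linarith
  have hcomm : ∀ t : ℝ, 0 ≤ t → Commute Ainv (T t) :=
    fun t ht => inverse_generator_comm hTsemi hgen hAinv₁ hAinv₂ ht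
  obtain ⟨m, rfl⟩ : ∃ m, n = m + 1 := ⟨n - 1, by omega⟩
  obtain ⟨C, hC, hmoment⟩ := exists_moment_inequality (by positivity)
    (landau_inequality hT0 hTsemi hTcont hK fun x => (hgen _ _).1 (hAinv₁ x)) m
  set N : ℝ := ((m + 1 : ℕ) : ℝ) with hN
  have hN0 : 0 < N := by positivity
  set E : ℝ := C * K ^ m * (K ^ p * M) ^ p⁻¹ with hE
  have hE0 : 0 ≤ E := by positivity
  refine ⟨E ^ N⁻¹ + 1, by positivity, 1, one_pos, fun t ht => ?_⟩
  have ht0 : 0 < t := by linarith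
  refine ContinuousLinearMap.opNorm_le_bound _ (by positivity) fun x => ?_
  have hdecay : ‖(Ainv ^ (m + 1)) (T t x)‖ ≤ (K ^ p * M) ^ p⁻¹ * t ^ (-p⁻¹) * ‖x‖ := by
    have h := mul_rpow_norm_le_of_admissible hTsemi hK
      (fun s hs => (hcomm s hs).pow_left (m + 1)) hp0.le hM.le (hadm x) ht0.le
    refine (Real.rpow_le_rpow_iff (norm_nonneg _) (by positivity) hp0).1 ?_
    rw [Real.mul_rpow (by positivity) (by positivity),
      Real.mul_rpow (by positivity) (by positivity),
      ← Real.rpow_mul (by positivity), ← Real.rpow_mul ht0.le, inv_mul_cancel₀ hp0.ne',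
      Real.rpow_one, neg_mul, inv_mul_cancel₀ hp0.ne', Real.rpow_neg_one]
    refine le_of_mul_le_mul_left (h.trans_eq ?_) ht0
    field_simp
  have hpow : ‖Ainv (T t x)‖ ^ (m + 1) ≤ (E ^ N⁻¹ * t ^ (-(1 / (N * p))) * ‖x‖) ^ (m + 1) :=
    calc ‖Ainv (T t x)‖ ^ (m + 1)
        ≤ C * ‖T t x‖ ^ m * ‖(Ainv ^ (m + 1)) (T t x)‖ := hmoment _
      _ ≤ C * (K * ‖x‖) ^ m * ((K ^ p * M) ^ p⁻¹ * t ^ (-p⁻¹) * ‖x‖) := by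
          gcongr
          exact (T t).le_of_opNorm_le (hK t ht0.le) x
      _ = E * t ^ (-p⁻¹) * ‖x‖ ^ (m + 1) := by rw [hE]; ring
      _ = (E ^ N⁻¹ * t ^ (-(1 / (N * p))) * ‖x‖) ^ (m + 1) := by
          rw [mul_pow, mul_pow, ← Real.rpow_natCast (E ^ N⁻¹), ← Real.rpow_natCast (t ^ _),
            ← Real.rpow_mul hE0, ← Real.rpow_mul ht0.le, ← hN, inv_mul_cancel₀ hN0.ne',
            Real.rpow_one]
          congr 3
          field_simp
  have hle := le_of_pow_le_pow_left₀ (Nat.succ_ne_zero m) (by positivity) hpow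
  have heq : (T t ∘L Ainv) x = Ainv (T t x) := by
    simpa using (congrArg (fun L : X →L[ℂ] X => L x) (hcomm t ht0.le).eq).symm
  rw [heq]
  refine hle.trans ?_
  gcongr
  linarith
end

section
/- For n ≥ 1 write λ_n := −1/n + i n ∈ ℂ and let z^{-α} denote the principal branch power for z in the right half-plane. For a fixed real α > 0, the following are equivalent: (a) α ≥ 1/2; (b) there exists K > 0 such that for all λ ∈ ℂ with Re λ > 0 and all integers n ≥ 1, |(1/n − i n)^{-α}| / |λ + 1/n − i n| ≤ K / √(Re λ). (Equivalence (b) states that the diagonal operator (−A)^{-α} on ℓ²(ℕ), where A is the diagonal operator with eigenvalues λ_n, satisfies the 2-Weiss condition for A, since the operator norm of the diagonal operator x ↦ ((λ_n)^{... }) is the supremum of the absolute values of its diagonal entries.) -/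
theorem natCast_le_norm_inv_sub_mul_I (n : ℕ) :
    (n : ℝ) ≤ ‖1 / (n : ℂ) - (n : ℂ) * Complex.I‖ := by
  have him : (1 / (n : ℂ) - (n : ℂ) * Complex.I).im = -(n : ℝ) := by
    rw [show (1 / (n : ℂ)) = ((1 / (n : ℝ) : ℝ) : ℂ) by push_cast; rfl]
    simp [-Complex.ofReal_div, -Complex.ofReal_inv, -one_div]
  have h := Complex.abs_im_le_norm (1 / (n : ℂ) - (n : ℂ) * Complex.I)
  rwa [him, abs_neg, Nat.abs_cast] at h

theorem norm_inv_sub_mul_I_le {n : ℕ} (hn : 1 ≤ n) :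
    ‖1 / (n : ℂ) - (n : ℂ) * Complex.I‖ ≤ 2 * n := by
  have hn' : (1 : ℝ) ≤ n := by exact_mod_cast hn
  calc ‖1 / (n : ℂ) - (n : ℂ) * Complex.I‖
      ≤ ‖1 / (n : ℂ)‖ + ‖(n : ℂ) * Complex.I‖ := norm_sub_le _ _
    _ = 1 / n + n := by simp
    _ ≤ 2 * n := by
      have : 1 / (n : ℝ) ≤ 1 := by rw [div_le_one] <;> linarith
      linarith

theorem norm_inv_sub_mul_I_cpow (n : ℕ) (α : ℝ) :
    ‖(1 / (n : ℂ) - (n : ℂ) * Complex.I) ^ (-(α : ℂ))‖ =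
      ‖1 / (n : ℂ) - (n : ℂ) * Complex.I‖ ^ (-α) := by
  rw [← Complex.ofReal_neg, Complex.norm_cpow_real]

theorem re_add_inv_le_norm (lam : ℂ) (n : ℕ) :
    lam.re + 1 / n ≤ ‖lam + 1 / (n : ℂ) - (n : ℂ) * Complex.I‖ := by
  have hre : (lam + 1 / (n : ℂ) - (n : ℂ) * Complex.I).re = lam.re + 1 / (n : ℝ) := by
    rw [show (1 / (n : ℂ)) = ((1 / (n : ℝ) : ℝ) : ℂ) by push_cast; rfl]
    simp [-Complex.ofReal_div, -Complex.ofReal_inv, -one_div]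
  exact hre ▸ Complex.re_le_norm _

/-- For the diagonal operator `A` on `ℓ²(ℕ)` with eigenvalues
`λ_n = -1/n + i n`, the operator `(−A)^{-α}` (principal branch powers) satisfies the
2-Weiss condition for `A` if and only if `α ≥ 1/2`.  The 2-Weiss condition is expressed
entrywise, the operator norm of a diagonal operator being the supremum of the absolute
values of its entries. -/
theorem stmt_10 (α : ℝ) (hα : 0 < α) :
    (1 / 2 ≤ α) ↔
      (∃ K > 0, ∀ lam : ℂ, 0 < lam.re → ∀ n : ℕ, 1 ≤ n →
        ‖(1 / (n : ℂ) - (n : ℂ) * Complex.I) ^ (-(α : ℂ))‖ /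
            ‖lam + 1 / (n : ℂ) - (n : ℂ) * Complex.I‖
          ≤ K / Real.sqrt lam.re) := by
  constructor
  · intro h
    refine ⟨1, one_pos, fun lam hlam n hn => ?_⟩
    have hn' : (1 : ℝ) ≤ n := by exact_mod_cast hn
    have hn0 : (0 : ℝ) < n := by linarith
    have hpow : ‖1 / (n : ℂ) - (n : ℂ) * Complex.I‖ ^ (-α) ≤ Real.sqrt (1 / n) := by
      calc ‖1 / (n : ℂ) - (n : ℂ) * Complex.I‖ ^ (-α) ≤ (n : ℝ) ^ (-α) :=
            Real.rpow_le_rpow_of_nonpos hn0 (natCast_le_norm_inv_sub_mul_I n) (by linarith)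
        _ ≤ (n : ℝ) ^ (-(1 / 2) : ℝ) := Real.rpow_le_rpow_of_exponent_le hn' (by linarith)
        _ = Real.sqrt (1 / n) := by
            rw [Real.rpow_neg hn0.le, ← Real.sqrt_eq_rpow, one_div, Real.sqrt_inv]
    have hd := re_add_inv_le_norm lam n
    have hinv : 0 < 1 / (n : ℝ) := by positivity
    rw [norm_inv_sub_mul_I_cpow, div_le_div_iff₀ (by linarith) (Real.sqrt_pos.2 hlam), one_mul]
    calc _ ≤ Real.sqrt (1 / n) * Real.sqrt lam.re := by gcongr
      _ ≤ lam.re + 1 / n := by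
          nlinarith [Real.sq_sqrt hinv.le, Real.sq_sqrt hlam.le,
            sq_nonneg (Real.sqrt (1 / n) - Real.sqrt lam.re)]
      _ ≤ _ := hd
  · rintro ⟨K, -, hK⟩
    by_contra! hlt
    have hbound : ∀ n : ℕ, 1 ≤ n → (n : ℝ) ^ (1 / 2 - α) ≤ 2 * K * 2 ^ α := by
      intro n hn
      have hn0 : (0 : ℝ) < n := by exact_mod_cast hn
      have h := hK (((1 / n : ℝ) : ℂ) + (n : ℂ) * Complex.I)
      have hre : (((1 / n : ℝ) : ℂ) + (n : ℂ) * Complex.I).re = 1 / n := by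
        simp [-Complex.ofReal_div, -Complex.ofReal_inv, -one_div]
      rw [hre] at h
      have h := h (by positivity) n hn
      have hden : ‖((1 / n : ℝ) : ℂ) + (n : ℂ) * Complex.I + 1 / (n : ℂ) - (n : ℂ) * Complex.I‖
          = 2 / n := by
        have : ((1 / n : ℝ) : ℂ) + (n : ℂ) * Complex.I + 1 / (n : ℂ) - (n : ℂ) * Complex.I
            = 2 / n := by push_cast; ring
        rw [this]; simp
      have hlow : (2 * n : ℝ) ^ (-α) ≤ ‖1 / (n : ℂ) - (n : ℂ) * Complex.I‖ ^ (-α) :=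
        Real.rpow_le_rpow_of_nonpos (hn0.trans_le (natCast_le_norm_inv_sub_mul_I n))
          (norm_inv_sub_mul_I_le hn) (by linarith)
      rw [norm_inv_sub_mul_I_cpow, hden, one_div (n : ℝ), Real.sqrt_inv, div_inv_eq_mul,
        div_le_iff₀ (by positivity)] at h
      have h2 := hlow.trans h
      rw [Real.rpow_neg (by positivity), Real.mul_rpow (by norm_num) hn0.le,
        inv_le_iff_one_le_mul₀ (by positivity)] at h2
      rw [Real.rpow_sub hn0, ← Real.sqrt_eq_rpow, div_le_iff₀ (by positivity)]
      have hs : Real.sqrt n * Real.sqrt n = n := Real.mul_self_sqrt hn0.le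
      calc Real.sqrt n = Real.sqrt n * 1 := (mul_one _).symm
        _ ≤ Real.sqrt n * (K * Real.sqrt n * (2 / n) * (2 ^ α * n ^ α)) := by gcongr
        _ = (Real.sqrt n * Real.sqrt n) * (2 / n) * (K * 2 ^ α * n ^ α) := by ring
        _ = 2 * K * 2 ^ α * n ^ α := by rw [hs]; field_simp
    have htend : Filter.Tendsto (fun n : ℕ => (n : ℝ) ^ (1 / 2 - α)) Filter.atTop Filter.atTop :=
      (tendsto_rpow_atTop (by linarith)).comp tendsto_natCast_atTop_atTop
    obtain ⟨n, hn, hn1⟩ :=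
      ((htend.eventually_gt_atTop (2 * K * 2 ^ α)).and (Filter.eventually_ge_atTop 1)).exists
    exact (hbound n hn1).not_gt hn
end

section
/- For n ≥ 1 write λ_n := −1/n + i n ∈ ℂ and let z^{-α} denote the principal branch power for z in the right half-plane. For every α > 0 and every x = (x_n) ∈ ℓ²(ℕ), one has ∫₀^∞ Σ_{n=1}^∞ |(1/n − i n)^{-α} e^{λ_n t} x_n|² dt = (1/2) Σ_{n=1}^∞ (n^{1+2α}/(1+n⁴)^α) |x_n|². Consequently, the following are equivalent for fixed α > 0: (a) α ≥ 1/2; (b) there exists M > 0 such that ∫₀^∞ Σ_{n=1}^∞ |(1/n − i n)^{-α} e^{λ_n t} x_n|² dt ≤ M Σ_{n=1}^∞ |x_n|² for all x ∈ ℓ²(ℕ). -/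
open MeasureTheory

/-- The weight `s^{1+2α} / (1+s⁴)^α` produced by the eigenvalue `-1/s + i s`. -/
noncomputable def energyWeight (α s : ℝ) : ℝ := s ^ (1 + 2 * α) / (1 + s ^ (4 : ℕ)) ^ α

lemma energyWeight_nonneg (α : ℝ) {s : ℝ} (hs : 0 < s) : 0 ≤ energyWeight α s := by
  unfold energyWeight
  positivity

lemma norm_sq_one_div_sub_mul_I {s : ℝ} (hs : 0 < s) :
    ‖(1 / (s : ℂ) - (s : ℂ) * Complex.I)‖ ^ 2 = (1 + s ^ 4) / s ^ 2 := by
  have h : (1 / (s : ℂ) - (s : ℂ) * Complex.I) = ((1 / s : ℝ) : ℂ) + ((-s : ℝ) : ℂ) * Complex.I := by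
    push_cast
    ring
  rw [h, Complex.sq_norm, Complex.normSq_add_mul_I]
  field_simp

lemma norm_sq_cpow_one_div_sub_mul_I (α : ℝ) {s : ℝ} (hs : 0 < s) :
    ‖(1 / (s : ℂ) - (s : ℂ) * Complex.I) ^ (-(α : ℂ))‖ ^ 2 = energyWeight α s / s := by
  have h4 : 0 < 1 + s ^ 4 := by positivity
  rw [← Complex.ofReal_neg, Complex.norm_cpow_real, ← Real.rpow_natCast, ← Real.rpow_mul (by positivity),
    mul_comm (-α), Real.rpow_mul (by positivity), Real.rpow_natCast, norm_sq_one_div_sub_mul_I hs,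
    Real.rpow_neg (by positivity), Real.div_rpow h4.le (by positivity), ← Real.rpow_natCast s 2,
    ← Real.rpow_mul hs.le, energyWeight, Real.rpow_add hs, Real.rpow_one, inv_div]
  push_cast
  field_simp

lemma norm_sq_orbit_component (α t : ℝ) (z : ℂ) {s : ℝ} (hs : 0 < s) :
    ‖(1 / (s : ℂ) - (s : ℂ) * Complex.I) ^ (-(α : ℂ)) *
        Complex.exp ((-(1 / (s : ℂ)) + (s : ℂ) * Complex.I) * (t : ℂ)) * z‖ ^ 2
      = energyWeight α s / s * ‖z‖ ^ 2 * Real.exp (-(2 / s) * t) := by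
  have hre : ((-(1 / (s : ℂ)) + (s : ℂ) * Complex.I) * (t : ℂ)).re = -(1 / s) * t := by
    have h : (-(1 / (s : ℂ)) + (s : ℂ) * Complex.I) * (t : ℂ)
        = ((-(1 / s) * t : ℝ) : ℂ) + ((s * t : ℝ) : ℂ) * Complex.I := by
      push_cast
      ring
    rw [h, Complex.add_re, Complex.re_ofReal_mul, Complex.I_re, Complex.ofReal_re]
    ring
  rw [norm_mul, norm_mul, mul_pow, mul_pow, norm_sq_cpow_one_div_sub_mul_I α hs, Complex.norm_exp,
    hre, ← Real.exp_nat_mul]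
  have h : ((2 : ℕ) : ℝ) * (-(1 / s) * t) = -(2 / s) * t := by
    push_cast
    ring
  rw [h]
  ring

lemma lintegral_Ioi_ofReal_mul_exp_neg {c b : ℝ} (hc : 0 ≤ c) (hb : 0 < b) :
    ∫⁻ t in Set.Ioi (0 : ℝ), ENNReal.ofReal (c * Real.exp (-b * t)) = ENNReal.ofReal (c / b) := by
  have hint : IntegrableOn (fun t : ℝ => Real.exp (-b * t)) (Set.Ioi 0) :=
    integrableOn_exp_mul_Ioi (neg_lt_zero.mpr hb) 0
  rw [← ofReal_integral_eq_lintegral_ofReal (hint.const_mul c)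
    (Filter.Eventually.of_forall fun t => by positivity), integral_const_mul,
    integral_exp_mul_Ioi (neg_lt_zero.mpr hb)]
  congr 1
  simp
  field_simp

lemma lintegral_orbit_energy (α : ℝ) (x : ℕ → ℂ) :
    (∫⁻ t in Set.Ioi (0 : ℝ),
        ∑' n : ℕ, ENNReal.ofReal
          (‖(1 / ((n : ℂ) + 1) - ((n : ℂ) + 1) * Complex.I) ^ (-(α : ℂ)) *
              Complex.exp ((-(1 / ((n : ℂ) + 1)) + ((n : ℂ) + 1) * Complex.I) * (t : ℂ)) *
              x n‖ ^ 2))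
      = ENNReal.ofReal (1 / 2) *
          ∑' n : ℕ, ENNReal.ofReal (energyWeight α ((n : ℝ) + 1) * ‖x n‖ ^ 2) := by
  have hs (n : ℕ) : (0 : ℝ) < (n : ℝ) + 1 := by positivity
  have hcast (n : ℕ) : (n : ℂ) + 1 = (((n : ℝ) + 1 : ℝ) : ℂ) := by push_cast; rfl
  simp only [hcast, norm_sq_orbit_component α _ _ (hs _)]
  rw [lintegral_tsum fun n => by fun_prop, ← ENNReal.tsum_mul_left]
  refine tsum_congr fun n => ?_
  have hw := energyWeight_nonneg α (hs n)
  have := hs n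
  rw [lintegral_Ioi_ofReal_mul_exp_neg (by positivity) (by positivity),
    ← ENNReal.ofReal_mul (by norm_num)]
  congr 1
  field_simp

lemma energyWeight_le_one {α s : ℝ} (hα : 1 / 2 ≤ α) (hs : 1 ≤ s) : energyWeight α s ≤ 1 := by
  have h0 : 0 < s := by linarith
  rw [energyWeight, div_le_one (by positivity)]
  calc s ^ (1 + 2 * α) ≤ s ^ (((4 : ℕ) : ℝ) * α) :=
        Real.rpow_le_rpow_of_exponent_le hs (by push_cast; linarith)
    _ = (s ^ 4) ^ α := by rw [Real.rpow_mul h0.le, Real.rpow_natCast]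
    _ ≤ (1 + s ^ 4) ^ α := Real.rpow_le_rpow (by positivity) (by linarith) (by linarith)

lemma rpow_div_le_energyWeight {α s : ℝ} (hα : 0 ≤ α) (hs : 1 ≤ s) :
    s ^ (1 - 2 * α) / 2 ^ α ≤ energyWeight α s := by
  have h0 : 0 < s := by linarith
  have h4 : 1 ≤ s ^ 4 := one_le_pow₀ hs
  calc s ^ (1 - 2 * α) / 2 ^ α = s ^ (1 + 2 * α) / (2 * s ^ 4) ^ α := by
        rw [Real.mul_rpow (by norm_num) (by positivity), ← Real.rpow_natCast s 4,
          ← Real.rpow_mul h0.le, show 1 + 2 * α = (1 - 2 * α) + ((4 : ℕ) : ℝ) * α by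
            push_cast; ring, Real.rpow_add h0]
        field_simp
    _ ≤ energyWeight α s := by
        unfold energyWeight
        gcongr
        linarith

lemma tendsto_energyWeight_atTop {α : ℝ} (h0 : 0 ≤ α) (hα : α < 1 / 2) :
    Filter.Tendsto (energyWeight α) Filter.atTop Filter.atTop := by
  refine Filter.tendsto_atTop_mono' _ ?_
    ((tendsto_rpow_atTop (y := 1 - 2 * α) (by linarith)).atTop_div_const
      (show (0 : ℝ) < 2 ^ α by positivity))
  filter_upwards [Filter.eventually_ge_atTop 1] with s hs using rpow_div_le_energyWeight h0 hs

/-- For the diagonal semigroup with eigenvalues `λ_n = -1/n + i n` on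
`ℓ²(ℕ)` (indexed here by `n+1`, `n : ℕ`), the exact value of
`∫₀^∞ ‖(−A)^{-α}T(t)x‖² dt` is `(1/2)Σ n^{1+2α}/(1+n⁴)^α |x_n|²`; consequently
`(−A)^{-α}` is `L²`-infinite-time admissible if and only if `α ≥ 1/2`. -/
theorem stmt_11 (α : ℝ) (hα : 0 < α) :
    (∀ x : ℕ → ℂ, Summable (fun n => ‖x n‖ ^ 2) →
      (∫⁻ t in Set.Ioi (0 : ℝ),
          ∑' n : ℕ, ENNReal.ofReal
            (‖(1 / ((n : ℂ) + 1) - ((n : ℂ) + 1) * Complex.I) ^ (-(α : ℂ)) *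
                Complex.exp ((-(1 / ((n : ℂ) + 1)) + ((n : ℂ) + 1) * Complex.I) * (t : ℂ)) *
                x n‖ ^ 2))
        = ENNReal.ofReal (1 / 2) *
            ∑' n : ℕ, ENNReal.ofReal
              ((((n : ℝ) + 1) ^ (1 + 2 * α) / (1 + ((n : ℝ) + 1) ^ (4 : ℕ)) ^ α) *
                ‖x n‖ ^ 2)) ∧
    ((1 / 2 ≤ α) ↔
      (∃ M > 0, ∀ x : ℕ → ℂ, Summable (fun n => ‖x n‖ ^ 2) →
        (∫⁻ t in Set.Ioi (0 : ℝ),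
            ∑' n : ℕ, ENNReal.ofReal
              (‖(1 / ((n : ℂ) + 1) - ((n : ℂ) + 1) * Complex.I) ^ (-(α : ℂ)) *
                  Complex.exp ((-(1 / ((n : ℂ) + 1)) + ((n : ℂ) + 1) * Complex.I) * (t : ℂ)) *
                  x n‖ ^ 2))
          ≤ ENNReal.ofReal (M * ∑' n : ℕ, ‖x n‖ ^ 2))) := by
  refine ⟨fun x _ => lintegral_orbit_energy α x, ?_⟩
  simp only [lintegral_orbit_energy]
  constructor
  · refine fun h => ⟨1, one_pos, fun x hx => ?_⟩
    rw [one_mul, ENNReal.ofReal_tsum_of_nonneg (fun n => by positivity) hx]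
    calc _ ≤ 1 * ∑' n : ℕ, ENNReal.ofReal (energyWeight α ((n : ℝ) + 1) * ‖x n‖ ^ 2) := by
          gcongr
          exact ENNReal.ofReal_le_one.mpr (by norm_num)
      _ ≤ _ := by
          rw [one_mul]
          refine ENNReal.tsum_le_tsum fun n => ENNReal.ofReal_le_ofReal ?_
          exact mul_le_of_le_one_left (by positivity)
            (energyWeight_le_one h (le_add_of_nonneg_left n.cast_nonneg))
  · rintro ⟨M, hM, h⟩
    by_contra! hlt
    obtain ⟨k, hk⟩ := (((tendsto_energyWeight_atTop hα.le hlt).comp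
      (Filter.tendsto_atTop_add_const_right _ (1 : ℝ) tendsto_natCast_atTop_atTop)).eventually_gt_atTop
        (2 * M)).exists
    have hx : ∀ n ≠ k, ‖(Pi.single k 1 : ℕ → ℂ) n‖ ^ 2 = 0 := fun n hn => by simp [hn]
    have hsum := h (Pi.single k 1) (hasSum_single k hx).summable
    rw [tsum_eq_single k hx, tsum_eq_single k fun n hn => by rw [hx n hn]; simp,
      ← ENNReal.ofReal_mul (by norm_num), ENNReal.ofReal_le_ofReal_iff (by simp [hM.le])] at hsum
    simp only [Pi.single_eq_same, norm_one, Function.comp_apply] at hsum hk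
    linarith
end

section
/- For n ≥ 1 write λ_n := −1/n + i n. Define g(t) := sup_{n≥1} n e^{-t/n}/√(1+n⁴) for t ≥ 0 (this is the operator norm ‖T(t)A⁻¹‖ for the diagonal operator A on ℓ²(ℕ) with eigenvalues λ_n and its semigroup T(t)). Then: (1) t · g(t) ≤ e⁻¹ for all t ≥ 0; and (2) liminf_{t→∞} t · g(t) ≥ e⁻¹. In particular, ‖T(t)A⁻¹‖ = O(1/t) as t → ∞ and this rate of decay cannot be improved. -/
theorem mul_mul_exp_div_sqrt_le {x : ℝ} (hx : 0 < x) (t : ℝ) (ht : 0 ≤ t) :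
    t * (x * Real.exp (-t / x) / Real.sqrt (1 + x ^ 4)) ≤ (Real.exp 1)⁻¹ := by
  have hsq : x ^ 2 ≤ Real.sqrt (1 + x ^ 4) := Real.le_sqrt_of_sq_le (by nlinarith)
  have h : x * Real.exp (-t / x) / Real.sqrt (1 + x ^ 4) ≤ x * Real.exp (-t / x) / x ^ 2 := by
    gcongr
  have hexp : t / x * Real.exp (-(t / x)) ≤ Real.exp (-1) := by
    have h1 : t / x ≤ Real.exp (t / x - 1) := by
      linarith [Real.add_one_le_exp (t / x - 1)]
    calc t / x * Real.exp (-(t / x)) ≤ Real.exp (t / x - 1) * Real.exp (-(t / x)) := by gcongr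
      _ = Real.exp (-1) := by rw [← Real.exp_add]; congr 1; ring
  calc t * (x * Real.exp (-t / x) / Real.sqrt (1 + x ^ 4))
      ≤ t * (x * Real.exp (-t / x) / x ^ 2) := by gcongr
    _ = t / x * Real.exp (-(t / x)) := by rw [neg_div]; field_simp
    _ ≤ (Real.exp 1)⁻¹ := by rwa [← Real.exp_neg]

theorem bddAbove_range_mul_exp_div_sqrt {t : ℝ} (ht : 0 ≤ t) :
    BddAbove (Set.range fun n : ℕ => ((n : ℝ) + 1) * Real.exp (-t / ((n : ℝ) + 1)) /
      Real.sqrt (1 + ((n : ℝ) + 1) ^ 4)) := by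
  refine ⟨1, ?_⟩
  rintro _ ⟨n, rfl⟩
  have hn : (0 : ℝ) ≤ n := n.cast_nonneg
  have hexp : Real.exp (-t / ((n : ℝ) + 1)) ≤ 1 := by
    rw [Real.exp_le_one_iff, neg_div, neg_nonpos]
    positivity
  have hsq : (n : ℝ) + 1 ≤ Real.sqrt (1 + ((n : ℝ) + 1) ^ 4) :=
    Real.le_sqrt_of_sq_le (by nlinarith [sq_nonneg (((n : ℝ) + 1) ^ 2 - 1)])
  refine div_le_one_of_le₀ ?_ (Real.sqrt_nonneg _)
  nlinarith

theorem mul_iSup_mul_exp_div_sqrt_le {t : ℝ} (ht : 0 ≤ t) :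
    t * (⨆ n : ℕ, ((n : ℝ) + 1) * Real.exp (-t / ((n : ℝ) + 1)) /
      Real.sqrt (1 + ((n : ℝ) + 1) ^ 4)) ≤ (Real.exp 1)⁻¹ := by
  rw [Real.mul_iSup_of_nonneg ht]
  exact ciSup_le fun n => mul_mul_exp_div_sqrt_le (by positivity) t ht

theorem le_mul_iSup_mul_exp_div_sqrt {t : ℝ} (ht : 2 ≤ t) :
    (Real.exp 1)⁻¹ * (1 - 2 / t) ≤ t * (⨆ n : ℕ, ((n : ℝ) + 1) *
      Real.exp (-t / ((n : ℝ) + 1)) / Real.sqrt (1 + ((n : ℝ) + 1) ^ 4)) := by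
  have ht0 : 0 < t := by linarith
  refine le_trans ?_ (mul_le_mul_of_nonneg_left
    (le_ciSup (bddAbove_range_mul_exp_div_sqrt ht0.le) ⌊t⌋₊) ht0.le)
  have h1 := Nat.floor_le ht0.le
  have h2 := Nat.lt_floor_add_one t
  obtain ⟨x, hx⟩ : ∃ x : ℝ, x = (⌊t⌋₊ : ℝ) + 1 := ⟨_, rfl⟩
  have hxt : x - 1 ≤ t := by linarith
  rw [← hx] at h2 ⊢
  have hx0 : 0 < x := by linarith
  have hexp : (Real.exp 1)⁻¹ ≤ Real.exp (-t / x) := by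
    rw [← Real.exp_neg, Real.exp_le_exp, le_div_iff₀ hx0]
    linarith
  have hsq : Real.sqrt (1 + x ^ 4) ≤ x ^ 2 + 1 :=
    Real.sqrt_le_iff.2 ⟨by positivity, by nlinarith [sq_nonneg x]⟩
  have hrat : 1 - 2 / x ≤ (x - 1) * x / (x ^ 2 + 1) := by
    rw [one_sub_div hx0.ne', div_le_div_iff₀ hx0 (by positivity)]
    nlinarith
  calc (Real.exp 1)⁻¹ * (1 - 2 / t) ≤ (Real.exp 1)⁻¹ * (1 - 2 / x) := by gcongr
    _ ≤ (Real.exp 1)⁻¹ * ((x - 1) * x / (x ^ 2 + 1)) := by gcongr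
    _ = (x - 1) * (x * (Real.exp 1)⁻¹ / (x ^ 2 + 1)) := by ring
    _ ≤ t * (x * Real.exp (-t / x) / Real.sqrt (1 + x ^ 4)) := by gcongr


/-- With `g(t) = sup_{n≥1} n e^{-t/n}/√(1+n⁴) = ‖T(t)A⁻¹‖` for the
diagonal operator with eigenvalues `λ_n = -1/n + i n` (indexed here by `n+1`, `n : ℕ`):
`t·g(t) ≤ e⁻¹` for all `t ≥ 0`, and `liminf_{t→∞} t·g(t) ≥ e⁻¹`; so
`‖T(t)A⁻¹‖ = O(1/t)` and this rate is optimal. -/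
theorem stmt_12 :
    (∀ t : ℝ, 0 ≤ t →
      t * (⨆ n : ℕ, ((n : ℝ) + 1) * Real.exp (-t / ((n : ℝ) + 1)) /
            Real.sqrt (1 + ((n : ℝ) + 1) ^ 4))
        ≤ (Real.exp 1)⁻¹) ∧
    ((Real.exp 1)⁻¹ ≤
      Filter.liminf
        (fun t : ℝ =>
          t * (⨆ n : ℕ, ((n : ℝ) + 1) * Real.exp (-t / ((n : ℝ) + 1)) /
                Real.sqrt (1 + ((n : ℝ) + 1) ^ 4)))
        Filter.atTop) := by
  refine ⟨fun t ht => mul_iSup_mul_exp_div_sqrt_le ht, ?_⟩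
  have hlim : Filter.Tendsto (fun t : ℝ => (Real.exp 1)⁻¹ * (1 - 2 / t)) Filter.atTop
      (nhds (Real.exp 1)⁻¹) := by
    simpa using ((Filter.tendsto_id.const_div_atTop (2 : ℝ)).const_sub 1).const_mul (Real.exp 1)⁻¹
  rw [← hlim.liminf_eq]
  refine Filter.liminf_le_liminf ?_ hlim.isBoundedUnder_ge ?_
  · filter_upwards [Filter.eventually_ge_atTop 2] with t ht
    exact le_mul_iSup_mul_exp_div_sqrt ht
  · refine Filter.IsBoundedUnder.isCoboundedUnder_ge ⟨(Real.exp 1)⁻¹, ?_⟩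
    rw [Filter.eventually_map]
    filter_upwards [Filter.eventually_ge_atTop 0] with t ht
    exact mul_iSup_mul_exp_div_sqrt_le ht
end

section
/- Let X and Y be complex Banach spaces, let (T(t))_{t≥0} be a bounded C₀-semigroup on X with generator A, and let C : X → Y be a bounded linear operator. Fix 0 ≤ β < 1 and γ ≥ 0. If there exist M, t₁ > 0 such that ‖C T(t)‖ ≤ M / (t^β (log t)^γ) for all t ≥ t₁, then there exists K > 0 such that ‖C R(λ,A)‖ ≤ K / ((Re λ)^{1-β} |log Re λ|^γ) for all λ with 0 < Re λ < 1. -/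
open MeasureTheory Set Filter Topology

/-- The orbit of a semigroup through a point of the domain of the generator is differentiable from
the right. -/
theorem hasDerivWithinAt_orbit_s13
    {X : Type*} [NormedAddCommGroup X] [NormedSpace ℂ X] {T : ℝ → X →L[ℂ] X}
    (hTsemi : ∀ s t : ℝ, 0 ≤ s → 0 ≤ t → T (s + t) = T s ∘L T t) {z y : X}
    (hz : Tendsto (fun t : ℝ => (t : ℂ)⁻¹ • (T t z - z)) (𝓝[>] 0) (𝓝 y))
    {t : ℝ} (ht : 0 ≤ t) :
    HasDerivWithinAt (fun u => T u z) (T t y) (Ioi t) t := by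
  rw [hasDerivWithinAt_iff_tendsto_slope' (by simp)]
  have hsub : Tendsto (fun u : ℝ => u - t) (𝓝[>] t) (𝓝[>] 0) := by
    refine tendsto_nhdsWithin_iff.2 ⟨?_, ?_⟩
    · have : Tendsto (fun u : ℝ => u - t) (𝓝 t) (𝓝 (t - t)) :=
        (continuous_id.sub continuous_const).tendsto t
      rw [sub_self] at this
      exact this.mono_left nhdsWithin_le_nhds
    · filter_upwards [self_mem_nhdsWithin] with u (hu : t < u)
      exact sub_pos.2 hu
  refine (((T t).continuous.tendsto y).comp (hz.comp hsub)).congr' ?_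
  filter_upwards [self_mem_nhdsWithin] with u (hu : t < u)
  have hadd := hTsemi t (u - t) ht (sub_pos.2 hu).le
  rw [add_sub_cancel] at hadd
  simp only [Function.comp_apply, map_smul, map_sub, slope, vsub_eq_sub, hadd,
    ContinuousLinearMap.comp_apply]
  rw [← Complex.ofReal_inv, Complex.coe_smul]

/-- An operator norm bound for a resolvent from an integrable majorant of the semigroup. -/
theorem norm_comp_resolvent_le
    {X : Type*} [NormedAddCommGroup X] [NormedSpace ℂ X]
    {Y : Type*} [NormedAddCommGroup Y] [NormedSpace ℂ Y] [CompleteSpace Y]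
    {T : ℝ → X →L[ℂ] X} (hT0 : T 0 = 1)
    (hTsemi : ∀ s t : ℝ, 0 ≤ s → 0 ≤ t → T (s + t) = T s ∘L T t)
    (hTcont : ∀ x : X, ContinuousOn (fun t : ℝ => T t x) (Ici 0))
    {c : ℝ} (hc : ∀ t : ℝ, 0 ≤ t → ‖T t‖ ≤ c) (C : X →L[ℂ] Y)
    {lam : ℂ} (hlam : 0 < lam.re) {Q : X →L[ℂ] X}
    (hQ : ∀ x, Tendsto (fun t : ℝ => (t : ℂ)⁻¹ • (T t (Q x) - Q x)) (𝓝[>] 0)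
      (𝓝 (lam • Q x - x)))
    {g : ℝ → ℝ} (hg : ∀ t, 0 < t → ‖C ∘L T t‖ * Real.exp (-lam.re * t) ≤ g t)
    (hgi : IntegrableOn g (Ioi 0)) :
    ‖C ∘L Q‖ ≤ ∫ t in Ioi 0, g t := by
  have hg0 : ∀ t, 0 < t → 0 ≤ g t := fun t ht => le_trans (by positivity) (hg t ht)
  have hexp : ∀ t : ℝ, ‖Complex.exp (-lam * t)‖ = Real.exp (-lam.re * t) := by
    intro t
    simp [Complex.norm_exp]
  refine ContinuousLinearMap.opNorm_le_bound _ (setIntegral_nonneg measurableSet_Ioi hg0) ?_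
  intro x
  have hcontexp : Continuous fun t : ℝ => Complex.exp (-lam * t) := by fun_prop
  have hcont : ∀ w : X, ContinuousOn (fun t : ℝ => Complex.exp (-lam * t) • C (T t w)) (Ici 0) :=
    fun w => hcontexp.continuousOn.smul (C.continuous.comp_continuousOn (hTcont w))
  have hderiv : ∀ t : ℝ, 0 ≤ t →
      HasDerivWithinAt (fun t : ℝ => Complex.exp (-lam * t) • C (T t (Q x)))
        (-(Complex.exp (-lam * t) • C (T t x))) (Ioi t) t := by
    intro t ht
    have h1 : HasDerivWithinAt (fun u => C (T u (Q x))) (C (T t (lam • Q x - x))) (Ioi t) t :=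
      (C.restrictScalars ℝ).hasFDerivAt.comp_hasDerivWithinAt t
        (hasDerivWithinAt_orbit_s13 hTsemi (hQ x) ht)
    have h2 : HasDerivAt (fun u : ℝ => Complex.exp (-lam * u))
        (Complex.exp (-lam * t) * (-lam * 1)) t :=
      (((hasDerivAt_id t).ofReal_comp).const_mul (-lam)).cexp
    refine (h2.hasDerivWithinAt.smul h1).congr_deriv ?_
    simp only [map_sub, map_smul, smul_sub, smul_smul, mul_one]
    rw [mul_neg, neg_smul]
    abel
  have hfin : ∀ s : ℝ, 0 ≤ s → ‖C (Q x)‖ ≤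
      Real.exp (-lam.re * s) * (‖C‖ * (c * ‖Q x‖)) + (∫ t in Ioi 0, g t) * ‖x‖ := by
    intro s hs
    have hsub : uIcc 0 s ⊆ Ici 0 := by
      rw [uIcc_of_le hs]
      exact Icc_subset_Ici_self
    have hFTC := intervalIntegral.integral_eq_sub_of_hasDeriv_right ((hcont (Q x)).mono hsub)
      (fun t ht => hderiv t (by rw [min_eq_left hs] at ht; exact ht.1.le))
      (((hcont x).mono hsub).neg.intervalIntegrable)
    simp only [Complex.ofReal_zero, mul_zero, Complex.exp_zero, one_smul, hT0,
      one_apply_eq_self] at hFTC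
    have hgI : IntegrableOn (fun t => g t * ‖x‖) (Ioi 0) := hgi.mul_const _
    have hnorm : ‖∫ t in (0 : ℝ)..s, -(Complex.exp (-lam * t) • C (T t x))‖ ≤
        ∫ t in (0 : ℝ)..s, g t * ‖x‖ := by
      refine intervalIntegral.norm_integral_le_of_norm_le hs (ae_of_all _ fun t ht => ?_) ?_
      · rw [norm_neg, norm_smul, hexp]
        have := (C ∘L T t).le_opNorm x
        calc Real.exp (-lam.re * t) * ‖C (T t x)‖
            ≤ Real.exp (-lam.re * t) * (‖C ∘L T t‖ * ‖x‖) := by gcongr; exact this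
          _ = ‖C ∘L T t‖ * Real.exp (-lam.re * t) * ‖x‖ := by ring
          _ ≤ g t * ‖x‖ := by gcongr; exact hg t ht.1
      · rw [intervalIntegrable_iff_integrableOn_Ioc_of_le hs]
        exact hgI.mono_set Ioc_subset_Ioi_self
    have hle : ∫ t in (0 : ℝ)..s, g t * ‖x‖ ≤ (∫ t in Ioi 0, g t) * ‖x‖ := by
      rw [intervalIntegral.integral_of_le hs, ← integral_mul_const]
      refine setIntegral_mono_set hgI ?_ (LE.le.eventuallyLE Ioc_subset_Ioi_self)
      filter_upwards [ae_restrict_mem measurableSet_Ioi] with t ht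
      exact mul_nonneg (hg0 t ht) (norm_nonneg x)
    have hend : ‖Complex.exp (-lam * s) • C (T s (Q x))‖ ≤
        Real.exp (-lam.re * s) * (‖C‖ * (c * ‖Q x‖)) := by
      rw [norm_smul, hexp]
      gcongr
      exact C.le_opNorm_of_le ((T s).le_of_opNorm_le (hc s hs) _)
    calc ‖C (Q x)‖ = ‖Complex.exp (-lam * s) • C (T s (Q x)) -
          ∫ t in (0 : ℝ)..s, -(Complex.exp (-lam * t) • C (T t x))‖ := by
            rw [hFTC, sub_sub_cancel]
      _ ≤ _ := (norm_sub_le _ _).trans (add_le_add hend (hnorm.trans hle))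
  have hlim : Tendsto (fun s : ℝ => Real.exp (-lam.re * s) * (‖C‖ * (c * ‖Q x‖)) +
      (∫ t in Ioi 0, g t) * ‖x‖) atTop
      (𝓝 (0 * (‖C‖ * (c * ‖Q x‖)) + (∫ t in Ioi 0, g t) * ‖x‖)) := by
    refine Tendsto.add_const _ (Tendsto.mul_const _ ?_)
    exact Real.tendsto_exp_atBot.comp
      (tendsto_id.const_mul_atTop_of_neg (neg_lt_zero.2 hlam))
  rw [zero_mul, zero_add] at hlim
  exact ge_of_tendsto hlim ((eventually_ge_atTop 0).mono hfin)

/-- Powers of `|log ξ|` are dominated by negative powers of `ξ` on `(0, 1)`. -/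
theorem rpow_mul_abs_log_rpow_le {p γ ξ : ℝ} (hp : 0 < p) (hγ : 0 ≤ γ) (hξ0 : 0 < ξ)
    (hξ1 : ξ < 1) :
    ξ ^ p * |Real.log ξ| ^ γ ≤ (1 / (p / (γ + 1))) ^ γ := by
  have hδ : 0 < p / (γ + 1) := by positivity
  have h := (Real.abs_log_mul_self_rpow_lt ξ _ hξ0 hξ1.le hδ).le
  rw [abs_mul, abs_of_pos (Real.rpow_pos_of_pos hξ0 _)] at h
  have hle : p / (γ + 1) * γ ≤ p := by
    rw [div_mul_eq_mul_div, div_le_iff₀ (by positivity)]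
    nlinarith
  calc ξ ^ p * |Real.log ξ| ^ γ ≤ ξ ^ (p / (γ + 1) * γ) * |Real.log ξ| ^ γ := by
        gcongr ?_ * _
        exact Real.rpow_le_rpow_of_exponent_ge hξ0 hξ1.le hle
    _ = (|Real.log ξ| * ξ ^ (p / (γ + 1))) ^ γ := by
        rw [Real.mul_rpow (abs_nonneg _) (by positivity), Real.rpow_mul hξ0.le, mul_comm]
    _ ≤ _ := by gcongr

/-- For a bounded C₀-semigroup on a Banach space with generator `A` and a
bounded operator `C : X → Y`, the decay `‖C T(t)‖ ≤ M/(t^β (log t)^γ)` for large `t`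
(`0 ≤ β < 1`, `γ ≥ 0`) implies the resolvent bound
`‖C R(λ,A)‖ ≤ K/((Re λ)^{1-β} |log Re λ|^γ)` for `0 < Re λ < 1`. -/
theorem stmt_13
    {X : Type*} [NormedAddCommGroup X] [NormedSpace ℂ X] [CompleteSpace X]
    {Y : Type*} [NormedAddCommGroup Y] [NormedSpace ℂ Y] [CompleteSpace Y]
    (T : ℝ → X →L[ℂ] X)
    (hT0 : T 0 = 1)
    (hTsemi : ∀ s t : ℝ, 0 ≤ s → 0 ≤ t → T (s + t) = T s ∘L T t)
    (hTcont : ∀ x : X, ContinuousOn (fun t : ℝ => T t x) (Set.Ici 0))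
    (hTbdd : ∃ c : ℝ, ∀ t : ℝ, 0 ≤ t → ‖T t‖ ≤ c)
    (Dom : Set X) (A : X → X)
    (hgen : ∀ x y, (x ∈ Dom ∧ A x = y) ↔
      Filter.Tendsto (fun t : ℝ => (t : ℂ)⁻¹ • (T t x - x))
        (nhdsWithin 0 (Set.Ioi 0)) (nhds y))
    (R : ℂ → X →L[ℂ] X)
    (hR₁ : ∀ lam : ℂ, 0 < lam.re → ∀ x, R lam x ∈ Dom ∧ lam • R lam x - A (R lam x) = x)
    (hR₂ : ∀ lam : ℂ, 0 < lam.re → ∀ x ∈ Dom, R lam (lam • x - A x) = x)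
    (C : X →L[ℂ] Y)
    (β γ : ℝ) (hβ0 : 0 ≤ β) (hβ1 : β < 1) (hγ : 0 ≤ γ)
    (hdecay : ∃ M > 0, ∃ t₁ > 0, ∀ t : ℝ, t₁ ≤ t →
      ‖C ∘L (T t)‖ ≤ M / (t ^ β * Real.log t ^ γ)) :
    ∃ K > 0, ∀ lam : ℂ, 0 < lam.re → lam.re < 1 →
      ‖C ∘L (R lam)‖ ≤ K / (lam.re ^ (1 - β) * |Real.log lam.re| ^ γ) := by
  obtain ⟨c, hc⟩ := hTbdd
  obtain ⟨M, hM, t₁, ht₁, hdec⟩ := hdecay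
  have hc0 : 0 ≤ c := (norm_nonneg _).trans (hc 0 le_rfl)
  set p : ℝ := (1 - β) / 2 with hp_def
  have hp : 0 < p := by rw [hp_def]; linarith
  set D : ℝ := (1 / (p / (γ + 1))) ^ γ
  have hD : 0 ≤ D := by positivity
  have hΓ : 0 < Real.Gamma (1 - β) := Real.Gamma_pos_of_pos (by linarith)
  refine ⟨‖C‖ * c * (1 + t₁) * D + M / p ^ γ * Real.Gamma (1 - β), by positivity, ?_⟩
  intro lam hξ0 hξ1
  set ξ := lam.re
  set L := |Real.log ξ| with hL_def
  have hlogneg : Real.log ξ < 0 := Real.log_neg hξ0 hξ1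
  have hL : 0 < L := abs_pos.2 hlogneg.ne
  have hL' : L = -Real.log ξ := abs_of_neg hlogneg
  set a : ℝ := ξ ^ (-p) with ha_def
  have ha1 : 1 ≤ a := Real.one_le_rpow_of_pos_of_le_one_of_nonpos hξ0 hξ1.le (by linarith)
  have hloga : Real.log a = p * L := by
    rw [ha_def, Real.log_rpow hξ0, hL']
    ring
  set b : ℝ := (1 + t₁) * a with hb_def
  set P : ℝ := M / (p * L) ^ γ with hP_def
  have hP : 0 < P := by positivity
  have hN : ∀ t : ℝ, 0 ≤ t → ‖C ∘L T t‖ ≤ ‖C‖ * c := fun t ht =>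
    (C.opNorm_comp_le _).trans (by gcongr; exact hc t ht)
  have hb0 : 0 ≤ b := by positivity
  have hfirst : IntegrableOn ((Ioc 0 b).indicator fun _ : ℝ => ‖C‖ * c) (Ioi 0) := by
    refine Integrable.integrableOn ?_
    rw [integrable_indicator_iff measurableSet_Ioc]
    exact integrableOn_const (by simp)
  have hGamma : ∫ t in Ioi (0 : ℝ), t ^ (-β) * Real.exp (-(ξ * t)) =
      (1 / ξ) ^ (1 - β) * Real.Gamma (1 - β) := by
    rw [← Real.integral_rpow_mul_exp_neg_mul_Ioi (by linarith : 0 < 1 - β) hξ0]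
    simp
  have hsecond : IntegrableOn (fun t : ℝ => P * (t ^ (-β) * Real.exp (-(ξ * t)))) (Ioi 0) := by
    refine Integrable.const_mul ?_ P
    refine Integrable.of_integral_ne_zero ?_
    rw [hGamma]
    positivity
  have hmain := norm_comp_resolvent_le hT0 hTsemi hTcont hc C hξ0 (Q := R lam)
    (g := fun t => (Ioc 0 b).indicator (fun _ : ℝ => ‖C‖ * c) t +
      P * (t ^ (-β) * Real.exp (-(ξ * t)))) ?_ ?_ (hfirst.add hsecond)
  · refine hmain.trans ?_
    rw [integral_add hfirst hsecond, integral_const_mul, hGamma,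
      setIntegral_indicator measurableSet_Ioc, inter_eq_self_of_subset_right Ioc_subset_Ioi_self,
      setIntegral_const, Measure.real, Real.volume_Ioc, sub_zero, ENNReal.toReal_ofReal hb0,
      smul_eq_mul, le_div_iff₀ (by positivity)]
    have hsplit : ξ ^ (1 - β) = ξ ^ p * ξ ^ p := by
      rw [← Real.rpow_add hξ0]
      congr 1
      rw [hp_def]
      ring
    have hap : a * ξ ^ p = 1 := by
      rw [ha_def, ← Real.rpow_add hξ0, neg_add_cancel, Real.rpow_zero]
    have hlogbound : ξ ^ p * L ^ γ ≤ D := rpow_mul_abs_log_rpow_le hp hγ hξ0 hξ1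
    have hinv : (1 / ξ) ^ (1 - β) * ξ ^ (1 - β) = 1 := by
      rw [← Real.mul_rpow (by positivity) hξ0.le, one_div_mul_cancel hξ0.ne', Real.one_rpow]
    have hPL : P * L ^ γ = M / p ^ γ := by
      rw [hP_def, Real.mul_rpow hp.le hL.le]
      field_simp
    have e1 : b * (‖C‖ * c) * (ξ ^ (1 - β) * L ^ γ) =
        ‖C‖ * c * (1 + t₁) * (ξ ^ p * L ^ γ) := by
      rw [hsplit, hb_def]
      linear_combination (1 + t₁) * ‖C‖ * c * ξ ^ p * L ^ γ * hap
    have e2 : P * ((1 / ξ) ^ (1 - β) * Real.Gamma (1 - β)) * (ξ ^ (1 - β) * L ^ γ) =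
        M / p ^ γ * Real.Gamma (1 - β) := by
      rw [← hPL]
      linear_combination P * Real.Gamma (1 - β) * L ^ γ * hinv
    rw [add_mul, e1, e2]
    gcongr
  · intro x
    obtain ⟨hmem, heq⟩ := hR₁ lam hξ0 x
    refine (hgen _ _).1 ⟨hmem, ?_⟩
    nth_rewrite 3 [← heq]
    rw [sub_sub_cancel]
  · intro t ht
    rw [neg_mul]
    rcases le_or_gt t b with htb | htb
    · rw [indicator_of_mem (show t ∈ Ioc 0 b from ⟨ht, htb⟩)]
      have h1 : Real.exp (-(ξ * t)) ≤ 1 := Real.exp_le_one_iff.2 (by nlinarith)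
      have h2 : ‖C ∘L T t‖ * Real.exp (-(ξ * t)) ≤ ‖C‖ * c * 1 :=
        mul_le_mul (hN t ht.le) h1 (Real.exp_pos _).le (by positivity)
      have h3 : 0 ≤ P * (t ^ (-β) * Real.exp (-(ξ * t))) := by positivity
      linarith
    · rw [indicator_of_notMem (fun h => htb.not_ge h.2), zero_add, ← mul_assoc]
      gcongr
      have hat : a ≤ t := by nlinarith
      have hlog : p * L ≤ Real.log t := hloga ▸ Real.log_le_log (by positivity) hat
      calc ‖C ∘L T t‖ ≤ M / (t ^ β * Real.log t ^ γ) := hdec t (by nlinarith)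
        _ ≤ M / (t ^ β * (p * L) ^ γ) := by gcongr
        _ = P * t ^ (-β) := by
          rw [hP_def, Real.rpow_neg ht.le]
          field_simp
end

section
/- Let X and Y be complex Banach spaces, let (T(t))_{t≥0} be a bounded C₀-semigroup on X with generator A, and let C : X → Y be a bounded linear operator. Fix γ ≥ 0. If there exist M, t₁ > 0 such that ‖C T(t)‖ ≤ M / (t (log t)^γ) for all t ≥ t₁, then for every ξ₀ ∈ (0, e⁻¹) there exists K > 0 such that ‖C R(λ,A)‖ ≤ K F_γ(Re λ) for all λ with 0 < Re λ < ξ₀, where F_γ(ξ) := |log ξ|^{1−γ} if 0 ≤ γ < 1, F_γ(ξ) := log|log ξ| if γ = 1, and F_γ(ξ) := 1 if γ > 1, for 0 < ξ < e⁻¹. -/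
open Set Filter Topology

section Semigroup

variable {X : Type*} [NormedAddCommGroup X] [NormedSpace ℂ X]
  {Y : Type*} [NormedAddCommGroup Y] [NormedSpace ℂ Y]

/-- The orbit of a vector in the domain of the generator has a right derivative everywhere. -/
theorem semigroup_hasDerivWithinAt {T : ℝ → X →L[ℂ] X} (hT0 : T 0 = 1)
    (hTsemi : ∀ s t : ℝ, 0 ≤ s → 0 ≤ t → T (s + t) = T s ∘L T t) {u y : X}
    (hu : Tendsto (fun t : ℝ => (t : ℂ)⁻¹ • (T t u - u)) (𝓝[>] 0) (𝓝 y))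
    {t : ℝ} (ht : 0 ≤ t) :
    HasDerivWithinAt (fun s => T s u) (T t y) (Ici t) t := by
  have h0 : HasDerivWithinAt (fun s => T s u) y (Ici 0) 0 := by
    rw [hasDerivWithinAt_iff_tendsto_slope, Ici_sdiff_left]
    refine hu.congr fun s => ?_
    rw [slope_def_module, hT0, sub_zero, ← Complex.ofReal_inv, Complex.coe_smul]
    rfl
  have h1 : HasDerivWithinAt (fun s => T (s - t) u) y (Ici t) t := by
    have h0' : HasDerivWithinAt (fun s => T s u) y (Ici 0) (t - t) := by rwa [sub_self]
    have := h0'.scomp (h := fun s => s - t) (h' := 1) (s := Ici t) t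
      ((hasDerivAt_id t).sub_const t).hasDerivWithinAt (fun s (hs : t ≤ s) => sub_nonneg.2 hs)
    simpa [Function.comp_def] using this
  have h2 := ((T t).restrictScalars ℝ).hasFDerivAt.comp_hasDerivWithinAt t h1
  refine h2.congr_of_mem (fun s (hs : t ≤ s) => ?_) self_mem_Ici
  have := hTsemi t (s - t) ht (sub_nonneg.2 hs)
  rw [add_sub_cancel] at this
  simp [this]

/-- Right derivative of the rescaled orbit `t ↦ e^{-λt} D T(t) u`. -/
theorem rescaled_semigroup_hasDerivWithinAt {T : ℝ → X →L[ℂ] X} (hT0 : T 0 = 1)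
    (hTsemi : ∀ s t : ℝ, 0 ≤ s → 0 ≤ t → T (s + t) = T s ∘L T t) {u y : X}
    (hu : Tendsto (fun t : ℝ => (t : ℂ)⁻¹ • (T t u - u)) (𝓝[>] 0) (𝓝 y))
    (D : X →L[ℂ] Y) (lam : ℂ) {t : ℝ} (ht : 0 ≤ t) :
    HasDerivWithinAt (fun s : ℝ => Complex.exp (-lam * s) • D (T s u))
      (-(Complex.exp (-lam * t) • D (T t (lam • u - y)))) (Ici t) t := by
  have h1 := (D.restrictScalars ℝ).hasFDerivAt.comp_hasDerivWithinAt t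
    (semigroup_hasDerivWithinAt hT0 hTsemi hu ht)
  have h2 : HasDerivAt (fun s : ℝ => Complex.exp (-lam * s))
      (Complex.exp (-lam * t) * -lam) t := by
    have := (((hasDerivAt_id (t : ℂ)).const_mul (-lam)).cexp).comp_ofReal
    simpa using this
  have h3 := h2.hasDerivWithinAt.smul h1 (s := Ici t)
  refine h3.congr_deriv ?_
  simp only [Function.comp, ContinuousLinearMap.coe_restrictScalars', map_sub, map_smul, mul_smul,
    smul_sub, neg_smul, smul_neg]
  abel

theorem norm_exp_neg_mul_le_one {lam : ℂ} (hlam : 0 ≤ lam.re) {t : ℝ} (ht : 0 ≤ t) :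
    ‖Complex.exp (-lam * t)‖ ≤ 1 := by
  rw [Complex.norm_exp, Real.exp_le_one_iff]
  simpa using mul_nonneg hlam ht

/-- Increments of the rescaled orbit are controlled by an antiderivative of a bound for
`‖D T(t) (λu - Au)‖`. -/
theorem norm_rescaled_semigroup_sub_le {T : ℝ → X →L[ℂ] X} (hT0 : T 0 = 1)
    (hTsemi : ∀ s t : ℝ, 0 ≤ s → 0 ≤ t → T (s + t) = T s ∘L T t)
    (hTcont : ∀ x : X, ContinuousOn (fun t : ℝ => T t x) (Ici 0)) {u y : X}
    (hu : Tendsto (fun t : ℝ => (t : ℂ)⁻¹ • (T t u - u)) (𝓝[>] 0) (𝓝 y))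
    (D : X →L[ℂ] Y) {lam : ℂ} (hlam : 0 ≤ lam.re) {a b : ℝ} (ha : 0 ≤ a) (hab : a ≤ b)
    {B B' : ℝ → ℝ} (hB : ∀ t ∈ Icc a b, HasDerivAt B (B' t) t)
    (hbound : ∀ t ∈ Ico a b, ‖D (T t (lam • u - y))‖ ≤ B' t) :
    ‖Complex.exp (-lam * b) • D (T b u) - Complex.exp (-lam * a) • D (T a u)‖
      ≤ B b - B a := by
  refine image_norm_le_of_norm_deriv_right_le_deriv_boundary' (a := a) (b := b)
    (f := fun t : ℝ => Complex.exp (-lam * t) • D (T t u) - Complex.exp (-lam * a) • D (T a u))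
    (f' := fun t : ℝ => -(Complex.exp (-lam * t) • D (T t (lam • u - y))))
    (B := fun t => B t - B a) (B' := B') ?_ ?_ ?_ ?_ ?_ ?_ (right_mem_Icc.2 hab)
  · refine ContinuousOn.sub (ContinuousOn.smul (by fun_prop) ?_) continuousOn_const
    exact D.continuous.comp_continuousOn ((hTcont u).mono fun t ht => ha.trans ht.1)
  · intro t ht
    exact (rescaled_semigroup_hasDerivWithinAt hT0 hTsemi hu D lam (ha.trans ht.1)).sub_const _
  · simp
  · exact fun t ht => ((hB t ht).sub_const _).continuousAt.continuousWithinAt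
  · exact fun t ht => ((hB t (Ico_subset_Icc_self ht)).sub_const _).hasDerivWithinAt
  · intro t ht
    rw [norm_neg, norm_smul]
    exact (mul_le_of_le_one_left (norm_nonneg _)
      (norm_exp_neg_mul_le_one hlam (ha.trans ht.1))).trans (hbound t ht)

/-- A resolvent bound for a bounded semigroup, with a non-sharp constant. -/
theorem norm_le_div_re_of_bounded_semigroup {T : ℝ → X →L[ℂ] X} (hT0 : T 0 = 1)
    (hTsemi : ∀ s t : ℝ, 0 ≤ s → 0 ≤ t → T (s + t) = T s ∘L T t)
    (hTcont : ∀ x : X, ContinuousOn (fun t : ℝ => T t x) (Ici 0))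
    {c : ℝ} (hc : 1 ≤ c) (hTc : ∀ t : ℝ, 0 ≤ t → ‖T t‖ ≤ c) {u y : X}
    (hu : Tendsto (fun t : ℝ => (t : ℂ)⁻¹ • (T t u - u)) (𝓝[>] 0) (𝓝 y))
    {lam : ℂ} (hlam : 0 < lam.re) :
    ‖u‖ ≤ 2 * c * Real.log (2 * c) / lam.re * ‖lam • u - y‖ := by
  have hlog : 0 ≤ Real.log (2 * c) := Real.log_nonneg (by linarith)
  set τ := Real.log (2 * c) / lam.re with hτ
  have hτ0 : 0 ≤ τ := by positivity
  have h := norm_rescaled_semigroup_sub_le hT0 hTsemi hTcont hu (ContinuousLinearMap.id ℂ X)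
    hlam.le le_rfl hτ0 (B := fun t => t * (c * ‖lam • u - y‖))
    (B' := fun _ => c * ‖lam • u - y‖)
    (fun t _ => by simpa using (hasDerivAt_id t).mul_const (c * ‖lam • u - y‖))
    (fun t ht => (T t).le_of_opNorm_le (hTc t ht.1) _)
  have hexp : ‖Complex.exp (-lam * τ)‖ = (2 * c)⁻¹ := by
    have : (-lam * (τ : ℂ)).re = -Real.log (2 * c) := by
      simp [hτ]
      field_simp
    rw [Complex.norm_exp, this, Real.exp_neg, Real.exp_log (by linarith)]
  have h1 : ‖Complex.exp (-lam * τ) • T τ u‖ ≤ ‖u‖ / 2 := by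
    rw [norm_smul, hexp]
    calc (2 * c)⁻¹ * ‖T τ u‖ ≤ (2 * c)⁻¹ * (c * ‖u‖) := by
          gcongr
          exact (T τ).le_of_opNorm_le (hTc τ hτ0) _
      _ = ‖u‖ / 2 := by field_simp
  simp only [ContinuousLinearMap.id_apply, Complex.ofReal_zero, mul_zero, Complex.exp_zero,
    one_smul, hT0, one_apply_eq_self, zero_mul, sub_zero] at h
  have h2 := norm_sub_norm_le u (Complex.exp (-lam * τ) • T τ u)
  rw [norm_sub_rev] at h2
  have : 2 * c * Real.log (2 * c) / lam.re * ‖lam • u - y‖ = 2 * (τ * (c * ‖lam • u - y‖)) := by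
    rw [hτ]
    ring
  linarith

end Semigroup

/-- An antiderivative of `1 / (t (log t)^γ)` whose growth on `[b, b/ξ]` is controlled by
`F_γ(ξ)`. -/
theorem exists_antideriv_inv_mul_log_rpow {γ : ℝ} {b ξ₀ : ℝ} (hb : Real.exp 1 ≤ b)
    (hξ₀ : 0 < ξ₀) (hξ₀e : ξ₀ < (Real.exp 1)⁻¹) :
    ∃ G : ℝ → ℝ, (∀ t, 1 < t → HasDerivAt G (1 / (t * Real.log t ^ γ)) t) ∧
      ∃ K, 0 ≤ K ∧ ∀ ξ, 0 < ξ → ξ < ξ₀ →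
        1 ≤ K * (if γ < 1 then |Real.log ξ| ^ (1 - γ)
           else if γ = 1 then Real.log |Real.log ξ| else 1) ∧
        G (b / ξ) - G b ≤ K * (if γ < 1 then |Real.log ξ| ^ (1 - γ)
           else if γ = 1 then Real.log |Real.log ξ| else 1) := by
  have hb0 : 0 < b := (Real.exp_pos 1).trans_le hb
  have ha : 1 ≤ Real.log b := (Real.le_log_iff_exp_le hb0).2 hb
  have habs : ∀ ξ, 0 < ξ → ξ < (Real.exp 1)⁻¹ → |Real.log ξ| = -Real.log ξ ∧ 1 < |Real.log ξ| := by
    intro ξ h h'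
    have : Real.log ξ < -1 := by
      rw [Real.log_lt_iff_lt_exp h, Real.exp_neg]
      exact h'
    rw [abs_of_neg (by linarith)]
    exact ⟨rfl, by linarith⟩
  have hlog : ∀ ξ, 0 < ξ → ξ < ξ₀ → Real.log (b / ξ) = Real.log b + |Real.log ξ| := by
    intro ξ h h'
    rw [Real.log_div hb0.ne' h.ne', (habs ξ h (h'.trans hξ₀e)).1]
    ring
  have hmul : ∀ ξ, 0 < ξ → ξ < ξ₀ → Real.log (b / ξ) ≤ (1 + Real.log b) * |Real.log ξ| := by
    intro ξ h h'
    rw [hlog ξ h h']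
    nlinarith [(habs ξ h (h'.trans hξ₀e)).2]
  have hpow : γ ≠ 1 → ∀ t, 1 < t →
      HasDerivAt (fun t => Real.log t ^ (1 - γ) / (1 - γ)) (1 / (t * Real.log t ^ γ)) t := by
    intro hγ t ht
    have hl := Real.log_pos ht
    have h1 : 1 - γ ≠ 0 := sub_ne_zero.2 (Ne.symm hγ)
    refine (((Real.hasDerivAt_log (by linarith)).rpow_const (p := 1 - γ)
      (Or.inl hl.ne')).div_const (1 - γ)).congr_deriv ?_
    have : (1 - γ - 1 : ℝ) = -γ := by ring
    rw [this, Real.rpow_neg hl.le]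
    field_simp
  rcases lt_trichotomy γ 1 with hγ | hγ | hγ
  · simp only [hγ, if_true]
    have h1 : 0 < 1 - γ := by linarith
    refine ⟨_, hpow hγ.ne, max 1 ((1 + Real.log b) ^ (1 - γ) / (1 - γ)), by positivity, ?_⟩
    intro ξ h h'
    have hl := (habs ξ h (h'.trans hξ₀e)).2
    have hF : 1 ≤ |Real.log ξ| ^ (1 - γ) := Real.one_le_rpow hl.le h1.le
    refine ⟨?_, ?_⟩
    · nlinarith [le_max_left 1 ((1 + Real.log b) ^ (1 - γ) / (1 - γ))]
    · have hpos : 0 ≤ Real.log b ^ (1 - γ) / (1 - γ) := by positivity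
      have : Real.log (b / ξ) ^ (1 - γ) ≤ (1 + Real.log b) ^ (1 - γ) * |Real.log ξ| ^ (1 - γ) := by
        rw [← Real.mul_rpow (by linarith) (by linarith)]
        refine Real.rpow_le_rpow ?_ (hmul ξ h h') h1.le
        rw [hlog ξ h h']
        linarith
      calc _ ≤ Real.log (b / ξ) ^ (1 - γ) / (1 - γ) := by linarith
        _ ≤ (1 + Real.log b) ^ (1 - γ) * |Real.log ξ| ^ (1 - γ) / (1 - γ) := by gcongr
        _ = (1 + Real.log b) ^ (1 - γ) / (1 - γ) * |Real.log ξ| ^ (1 - γ) := by ring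
        _ ≤ _ := by gcongr; exact le_max_right _ _
  · subst hγ
    simp only [lt_irrefl, if_false, if_true]
    have hl₀ := (habs ξ₀ hξ₀ hξ₀e)
    have hF₀ : 0 < Real.log |Real.log ξ₀| := Real.log_pos hl₀.2
    have hab : 0 ≤ Real.log (1 + Real.log b) := Real.log_nonneg (by linarith)
    refine ⟨fun t => Real.log (Real.log t), ?_,
      (1 + Real.log (1 + Real.log b)) / Real.log |Real.log ξ₀| + 1, by positivity, ?_⟩
    · intro t ht
      have hl := Real.log_pos ht
      refine ((Real.hasDerivAt_log (by linarith)).log hl.ne').congr_deriv ?_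
      rw [Real.rpow_one]
      field_simp
    · intro ξ h h'
      have hl := habs ξ h (h'.trans hξ₀e)
      have hle : Real.log |Real.log ξ₀| ≤ Real.log |Real.log ξ| := by
        refine Real.log_le_log (by linarith) ?_
        rw [hl₀.1, hl.1]
        exact neg_le_neg (Real.log_le_log h h'.le)
      have hF : 1 + Real.log (1 + Real.log b) + Real.log |Real.log ξ| ≤
          ((1 + Real.log (1 + Real.log b)) / Real.log |Real.log ξ₀| + 1) *
            Real.log |Real.log ξ| := by
        rw [add_mul, one_mul]
        gcongr
        rw [div_mul_eq_mul_div, le_div_iff₀ hF₀]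
        gcongr
      refine ⟨by linarith, ?_⟩
      have h1 : Real.log (Real.log (b / ξ)) ≤
          Real.log (1 + Real.log b) + Real.log |Real.log ξ| := by
        rw [← Real.log_mul (by linarith) (by linarith)]
        refine Real.log_le_log ?_ (hmul ξ h h')
        rw [hlog ξ h h']
        linarith
      have h2 : 0 ≤ Real.log (Real.log b) := Real.log_nonneg ha
      linarith
  · simp only [not_lt.2 hγ.le, hγ.ne', if_false, mul_one]
    refine ⟨_, hpow hγ.ne', max 1 (Real.log b ^ (1 - γ) / (γ - 1)), by positivity, ?_⟩
    intro ξ h h'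
    refine ⟨le_max_left _ _, le_trans ?_ (le_max_right _ _)⟩
    have hl := (habs ξ h (h'.trans hξ₀e)).2
    have h1 : 0 < γ - 1 := by linarith
    have hpos : 0 ≤ Real.log (b / ξ) ^ (1 - γ) / (γ - 1) := by
      rw [hlog ξ h h']
      positivity
    have hneg : ∀ z : ℝ, z / (1 - γ) = -(z / (γ - 1)) := by
      intro z
      rw [← neg_sub γ 1, div_neg]
    simp only [hneg]
    linarith


/-- For a bounded C₀-semigroup on a Banach space with generator `A` and a
bounded operator `C : X → Y`, the decay `‖C T(t)‖ ≤ M/(t (log t)^γ)` for large `t`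
(`γ ≥ 0`) implies: for every `ξ₀ ∈ (0, e⁻¹)` there is `K > 0` with
`‖C R(λ,A)‖ ≤ K F_γ(Re λ)` for `0 < Re λ < ξ₀`, where `F_γ(ξ) = |log ξ|^{1-γ}` if
`0 ≤ γ < 1`, `F_γ(ξ) = log|log ξ|` if `γ = 1`, and `F_γ(ξ) = 1` if `γ > 1`. -/
theorem stmt_14
    {X : Type*} [NormedAddCommGroup X] [NormedSpace ℂ X] [CompleteSpace X]
    {Y : Type*} [NormedAddCommGroup Y] [NormedSpace ℂ Y] [CompleteSpace Y]
    (T : ℝ → X →L[ℂ] X)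
    (hT0 : T 0 = 1)
    (hTsemi : ∀ s t : ℝ, 0 ≤ s → 0 ≤ t → T (s + t) = T s ∘L T t)
    (hTcont : ∀ x : X, ContinuousOn (fun t : ℝ => T t x) (Set.Ici 0))
    (hTbdd : ∃ c : ℝ, ∀ t : ℝ, 0 ≤ t → ‖T t‖ ≤ c)
    (Dom : Set X) (A : X → X)
    (hgen : ∀ x y, (x ∈ Dom ∧ A x = y) ↔
      Filter.Tendsto (fun t : ℝ => (t : ℂ)⁻¹ • (T t x - x))
        (nhdsWithin 0 (Set.Ioi 0)) (nhds y))
    (R : ℂ → X →L[ℂ] X)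
    (hR₁ : ∀ lam : ℂ, 0 < lam.re → ∀ x, R lam x ∈ Dom ∧ lam • R lam x - A (R lam x) = x)
    (hR₂ : ∀ lam : ℂ, 0 < lam.re → ∀ x ∈ Dom, R lam (lam • x - A x) = x)
    (C : X →L[ℂ] Y)
    (γ : ℝ) (hγ : 0 ≤ γ)
    (hdecay : ∃ M > 0, ∃ t₁ > 0, ∀ t : ℝ, t₁ ≤ t →
      ‖C ∘L (T t)‖ ≤ M / (t * Real.log t ^ γ)) :
    ∀ ξ₀ : ℝ, 0 < ξ₀ → ξ₀ < (Real.exp 1)⁻¹ →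
      ∃ K > 0, ∀ lam : ℂ, 0 < lam.re → lam.re < ξ₀ →
        ‖C ∘L (R lam)‖ ≤ K *
          (if γ < 1 then |Real.log lam.re| ^ (1 - γ)
           else if γ = 1 then Real.log |Real.log lam.re|
           else 1) := by
  intro ξ₀ hξ₀ hξ₀e
  obtain ⟨c₀, hc₀⟩ := hTbdd
  obtain ⟨M, hM, t₁, -, hdec⟩ := hdecay
  set c := max 1 c₀
  have hc : 1 ≤ c := le_max_left _ _
  have hTc : ∀ t : ℝ, 0 ≤ t → ‖T t‖ ≤ c := fun t ht => (hc₀ t ht).trans (le_max_right _ _)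
  set b := max (Real.exp 1) t₁
  have hb : Real.exp 1 ≤ b := le_max_left _ _
  have hb1 : 1 < b := (Real.one_lt_exp_iff.2 one_pos).trans_le hb
  obtain ⟨G, hG, K₀, hK₀, hGK⟩ := exists_antideriv_inv_mul_log_rpow (γ := γ) hb hξ₀ hξ₀e
  set L := 2 * c * Real.log (2 * c)
  have hL : 0 ≤ L := mul_nonneg (by linarith) (Real.log_nonneg (by linarith))
  refine ⟨(M * L + M + b * (‖C‖ * c)) * K₀ + 1, by positivity, fun lam hre hlt => ?_⟩
  obtain ⟨hF1, hGF⟩ := hGK lam.re hre hlt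
  set F := if γ < 1 then |Real.log lam.re| ^ (1 - γ)
    else if γ = 1 then Real.log |Real.log lam.re| else 1
  have hF0 : 0 ≤ F := (pos_of_mul_pos_right (one_pos.trans_le hF1) hK₀).le
  refine ContinuousLinearMap.opNorm_le_bound _ (by positivity) fun x => ?_
  obtain ⟨hdom, hx⟩ := hR₁ lam hre x
  set u := R lam x
  have hu := (hgen u (A u)).1 ⟨hdom, rfl⟩
  have hres := norm_le_div_re_of_bounded_semigroup hT0 hTsemi hTcont hc hTc hu hre
  set τ := b / lam.re with hτ
  have hre1 : lam.re < 1 := hlt.trans (hξ₀e.trans (inv_lt_one_of_one_lt₀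
    (Real.one_lt_exp_iff.2 one_pos)))
  have hbτ : b ≤ τ := by
    rw [hτ, le_div_iff₀ hre]
    nlinarith
  have hstart := norm_rescaled_semigroup_sub_le hT0 hTsemi hTcont hu C
    hre.le le_rfl (zero_le_one.trans hb1.le) (B := fun t => t * (‖C‖ * c * ‖x‖))
    (B' := fun _ => ‖C‖ * c * ‖x‖)
    (fun t _ => by simpa using (hasDerivAt_id t).mul_const (‖C‖ * c * ‖x‖))
    (fun t ht => by
      rw [hx, mul_assoc]
      exact C.le_opNorm_of_le ((T t).le_of_opNorm_le (hTc t ht.1) _))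
  have htail := norm_rescaled_semigroup_sub_le hT0 hTsemi hTcont hu C
    hre.le (zero_le_one.trans hb1.le) hbτ (B := fun t => M * ‖x‖ * G t)
    (B' := fun t => M * ‖x‖ * (1 / (t * Real.log t ^ γ)))
    (fun t ht => (hG t (hb1.trans_le ht.1)).const_mul _)
    (fun t ht => by
      rw [hx]
      refine ((C ∘L T t).le_of_opNorm_le (hdec t ((le_max_right _ _).trans ht.1)) x).trans_eq ?_
      ring)
  have hend : ‖Complex.exp (-lam * τ) • C (T τ u)‖ ≤ M * L * ‖x‖ := by
    have hτ0 : 0 < τ := by linarith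
    have hlog : 1 ≤ Real.log τ ^ γ :=
      Real.one_le_rpow ((Real.le_log_iff_exp_le hτ0).2 (hb.trans hbτ)) hγ
    rw [hx] at hres
    rw [norm_smul]
    calc _ ≤ ‖C (T τ u)‖ := mul_le_of_le_one_left (norm_nonneg _)
          (norm_exp_neg_mul_le_one hre.le hτ0.le)
      _ ≤ M / (τ * Real.log τ ^ γ) * ‖u‖ :=
          (C ∘L T τ).le_of_opNorm_le (hdec τ ((le_max_right _ _).trans hbτ)) u
      _ ≤ M / τ * (L / lam.re * ‖x‖) := by
          gcongr
          exact le_mul_of_one_le_right hτ0.le hlog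
      _ = M * L * ‖x‖ / b := by
          rw [hτ]
          field_simp
      _ ≤ M * L * ‖x‖ := div_le_self (by positivity) hb1.le
  simp only [Complex.ofReal_zero, mul_zero, Complex.exp_zero, one_smul, hT0,
    one_apply_eq_self, zero_mul, sub_zero, ← mul_sub] at hstart htail
  have htri : ‖C u‖ ≤ M * L * ‖x‖ + M * ‖x‖ * (G τ - G b) + b * (‖C‖ * c * ‖x‖) := by
    have h1 := norm_sub_norm_le (C u) (Complex.exp (-lam * b) • C (T b u))
    have h2 := norm_sub_norm_le (Complex.exp (-lam * b) • C (T b u))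
      (Complex.exp (-lam * τ) • C (T τ u))
    rw [norm_sub_rev] at h1 h2
    linarith
  calc ‖(C ∘L R lam) x‖ ≤ _ := htri
    _ ≤ M * L * ‖x‖ * (K₀ * F) + M * ‖x‖ * (K₀ * F) + b * (‖C‖ * c * ‖x‖) * (K₀ * F) := by
        refine add_le_add (add_le_add ?_ ?_) ?_
        · exact le_mul_of_one_le_right (by positivity) hF1
        · exact mul_le_mul_of_nonneg_left hGF (by positivity)
        · exact le_mul_of_one_le_right (by positivity) hF1
    _ = (M * L + M + b * (‖C‖ * c)) * K₀ * F * ‖x‖ := by ring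
    _ ≤ _ := by
        gcongr
        linarith
end

section
/- Fix real numbers β and γ with 0 ≤ β < 1 and γ ≥ 0. For every t₀ > e^{γ/(1−β)} there exists M > 0 such that for all ξ with 0 < ξ < 1/t₀, ∫_{t₀}^∞ e^{-ξ t} / (t^β (log t)^γ) dt ≤ M / (ξ^{1−β} |log ξ|^γ). -/
open MeasureTheory

/-- Comparison of `log t` with `log T` for `t₀ ≤ t ≤ T`, with a power loss in `T / t`. -/
lemma log_rpow_le_rpow_mul_log_rpow {γ t₀ t T : ℝ} (hγ : 0 ≤ γ) (ht₀ : 1 < t₀) (ht : t₀ ≤ t)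
    (htT : t ≤ T) :
    Real.log T ^ γ ≤ (T / t) ^ (γ / Real.log t₀) * Real.log t ^ γ := by
  have ht0 : 0 < t := by linarith
  have hT0 : 0 < T := by linarith
  have hl₀ : 0 < Real.log t₀ := Real.log_pos ht₀
  have hl : Real.log t₀ ≤ Real.log t := Real.log_le_log (by linarith) ht
  have hlt : 0 < Real.log t := by linarith
  have hlT : Real.log t ≤ Real.log T := Real.log_le_log ht0 htT
  have hratio : 0 < Real.log T / Real.log t := div_pos (by linarith) hlt
  have hbound : Real.log T / Real.log t ≤ Real.exp (Real.log (T / t) / Real.log t₀) := by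
    have h₁ : Real.log T / Real.log t - 1 ≤ Real.log (T / t) / Real.log t₀ := by
      rw [Real.log_div hT0.ne' ht0.ne', div_sub_one hlt.ne']
      exact div_le_div_of_nonneg_left (by linarith) hl₀ hl
    linarith [Real.add_one_le_exp (Real.log (T / t) / Real.log t₀)]
  have hpow := Real.rpow_le_rpow hratio.le hbound hγ
  rw [← Real.exp_mul, Real.div_rpow (by linarith) hlt.le,
    div_le_iff₀ (Real.rpow_pos_of_pos hlt γ)] at hpow
  rwa [Real.rpow_def_of_pos (div_pos hT0 ht0), mul_div_left_comm, mul_comm γ]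

/-- Pointwise majorant of the integrand by Gamma-type integrands. -/
lemma exp_neg_mul_div_rpow_mul_log_rpow_le {β γ t₀ t ξ : ℝ} (hβ : 0 ≤ β) (hγ : 0 ≤ γ)
    (ht₀ : 1 < t₀) (ht : t₀ ≤ t) (hξ : 0 < ξ) (hξ₀ : ξ < 1 / t₀) :
    Real.exp (-(ξ * t)) / (t ^ β * Real.log t ^ γ) ≤
      (ξ ^ (-(γ / Real.log t₀)) * (t ^ (-(β + γ / Real.log t₀)) * Real.exp (-(ξ * t))) +
        ξ ^ β * (t ^ (0 : ℝ) * Real.exp (-(ξ * t)))) / |Real.log ξ| ^ γ := by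
  have ht0 : 0 < t := by linarith
  have hlt : 0 < Real.log t := Real.log_pos (by linarith)
  have hT : t₀ < ξ⁻¹ := by
    rw [lt_inv_comm₀ (by linarith) hξ]; simpa using hξ₀
  have habs : |Real.log ξ| = Real.log ξ⁻¹ := by
    rw [Real.log_inv, abs_of_neg]
    exact Real.log_neg hξ (by rw [← inv_one, lt_inv_comm₀ hξ one_pos]; linarith)
  have hL : 0 < Real.log ξ⁻¹ := Real.log_pos (by linarith)
  rw [habs]
  set δ := γ / Real.log t₀ with hδ
  have hLγ := Real.rpow_pos_of_pos hL γ
  have hlγ := Real.rpow_pos_of_pos hlt γ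
  have htβ := Real.rpow_pos_of_pos ht0 β
  have he := Real.exp_pos (-(ξ * t))
  rw [div_le_div_iff₀ (mul_pos htβ hlγ) hLγ]
  have hA : 0 < ξ ^ (-δ) * (t ^ (-(β + δ))) := by positivity
  have hB : 0 < ξ ^ β * t ^ (0 : ℝ) := by positivity
  suffices h : Real.log ξ⁻¹ ^ γ ≤
      (ξ ^ (-δ) * t ^ (-(β + δ)) + ξ ^ β * t ^ (0 : ℝ)) * (t ^ β * Real.log t ^ γ) by
    calc _ ≤ _ := mul_le_mul_of_nonneg_left h he.le
      _ = _ := by ring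
  rcases le_total t ξ⁻¹ with h | h
  · have key := log_rpow_le_rpow_mul_log_rpow hγ ht₀ ht h
    have heq : (ξ⁻¹ / t) ^ δ = ξ ^ (-δ) * t ^ (-(β + δ)) * t ^ β := by
      rw [mul_assoc, ← Real.rpow_add ht0, Real.div_rpow (by positivity) ht0.le,
        Real.inv_rpow hξ.le, ← Real.rpow_neg hξ.le, div_eq_mul_inv, ← Real.rpow_neg ht0.le]
      congr 2; ring
    rw [← hδ, heq] at key
    have : 0 ≤ ξ ^ β * t ^ (0 : ℝ) * (t ^ β * Real.log t ^ γ) := by positivity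
    linarith
  · have h₁ : 1 ≤ ξ ^ β * t ^ β := by
      rw [← Real.mul_rpow hξ.le ht0.le]
      exact Real.one_le_rpow (by rwa [inv_le_iff_one_le_mul₀' hξ] at h) hβ
    have h₂ : Real.log ξ⁻¹ ^ γ ≤ Real.log t ^ γ :=
      Real.rpow_le_rpow hL.le (Real.log_le_log (by positivity) h) hγ
    have h₃ : 0 ≤ ξ ^ (-δ) * t ^ (-(β + δ)) * (t ^ β * Real.log t ^ γ) := by positivity
    rw [Real.rpow_zero]
    nlinarith

/-- For `0 ≤ β < 1`, `γ ≥ 0` and every `t₀ > e^{γ/(1-β)}`, there exists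
`M > 0` such that `∫_{t₀}^∞ e^{-ξt}/(t^β (log t)^γ) dt ≤ M/(ξ^{1-β} |log ξ|^γ)` for all
`0 < ξ < 1/t₀`. -/
theorem stmt_15 (β γ : ℝ) (hβ0 : 0 ≤ β) (hβ1 : β < 1) (hγ : 0 ≤ γ) :
    ∀ t₀ : ℝ, Real.exp (γ / (1 - β)) < t₀ →
      ∃ M > 0, ∀ ξ : ℝ, 0 < ξ → ξ < 1 / t₀ →
        (∫⁻ t in Set.Ici t₀,
            ENNReal.ofReal (Real.exp (-(ξ * t)) / (t ^ β * Real.log t ^ γ)))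
          ≤ ENNReal.ofReal (M / (ξ ^ (1 - β) * |Real.log ξ| ^ γ)) := by
  intro t₀ ht₀
  have hβ' : 0 < 1 - β := by linarith
  have h1 : 1 < t₀ := (Real.one_le_exp (by positivity)).trans_lt ht₀
  have hl₀ : 0 < Real.log t₀ := Real.log_pos h1
  have hδ : γ / Real.log t₀ < 1 - β := by
    rw [div_lt_comm₀ hl₀ hβ']
    exact (Real.lt_log_iff_exp_lt (by linarith)).2 ht₀
  set δ := γ / Real.log t₀ with hδdef
  have hs : 0 < 1 - (β + δ) := by linarith
  refine ⟨Real.Gamma (1 - (β + δ)) + 1, by linarith [Real.Gamma_pos_of_pos hs], fun ξ hξ hξ₀ ↦ ?_⟩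
  have hint : ∀ s : ℝ, -1 < s →
      IntegrableOn (fun t : ℝ ↦ t ^ s * Real.exp (-(ξ * t))) (Set.Ioi 0) := fun s h ↦ by
    simpa using integrableOn_rpow_mul_exp_neg_mul_rpow h one_pos hξ
  have hi₁ := (hint (-(β + δ)) (by linarith)).const_mul (ξ ^ (-δ))
  have hi₂ := (hint 0 (by norm_num)).const_mul (ξ ^ β)
  have hv₁ : ∫ t in Set.Ioi (0 : ℝ), t ^ (-(β + δ)) * Real.exp (-(ξ * t)) =
      (1 / ξ) ^ (1 - (β + δ)) * Real.Gamma (1 - (β + δ)) := by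
    rw [← Real.integral_rpow_mul_exp_neg_mul_Ioi hs hξ]
    congr! 4; ring
  have hv₂ : ∫ t in Set.Ioi (0 : ℝ), t ^ (0 : ℝ) * Real.exp (-(ξ * t)) = 1 / ξ := by
    simpa using Real.integral_rpow_mul_exp_neg_mul_Ioi one_pos hξ
  calc _ ≤ ∫⁻ t in Set.Ici t₀, ENNReal.ofReal
        ((ξ ^ (-δ) * (t ^ (-(β + δ)) * Real.exp (-(ξ * t))) +
          ξ ^ β * (t ^ (0 : ℝ) * Real.exp (-(ξ * t)))) / |Real.log ξ| ^ γ) :=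
        setLIntegral_mono' measurableSet_Ici fun t ht ↦ ENNReal.ofReal_le_ofReal
          (exp_neg_mul_div_rpow_mul_log_rpow_le hβ0 hγ h1 ht hξ hξ₀)
    _ ≤ ∫⁻ t in Set.Ioi 0, ENNReal.ofReal
        ((ξ ^ (-δ) * (t ^ (-(β + δ)) * Real.exp (-(ξ * t))) +
          ξ ^ β * (t ^ (0 : ℝ) * Real.exp (-(ξ * t)))) / |Real.log ξ| ^ γ) :=
        lintegral_mono_set (Set.Ici_subset_Ioi.2 (by linarith))
    _ = _ := by
      rw [← ofReal_integral_eq_lintegral_ofReal (by exact (hi₁.add hi₂).div_const _)]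
      · congr 1
        rw [integral_div, integral_add hi₁ hi₂, integral_const_mul, integral_const_mul, hv₁, hv₂,
          ← div_div]
        congr 1
        rw [one_div, Real.inv_rpow hξ.le, ← Real.rpow_neg hξ.le, ← mul_assoc,
          ← Real.rpow_add hξ, ← div_eq_mul_inv, ← Real.rpow_sub_one hξ.ne', div_eq_mul_inv,
          ← Real.rpow_neg hξ.le, add_mul, one_mul, mul_comm]
        congr 2 <;> ring_nf
      · filter_upwards [ae_restrict_mem measurableSet_Ioi] with t ht
        have : 0 < t := ht
        simp only [Pi.zero_apply]
        positivity
end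

section
/- Fix a real number γ ≥ 0. For every t₀ > e there exists M > 0 such that for all ξ with 0 < ξ < 1/t₀, ∫_{t₀}^∞ e^{-ξ t} / (t (log t)^γ) dt ≤ M F_γ(ξ), where F_γ(ξ) := |log ξ|^{1−γ} if 0 ≤ γ < 1, F_γ(ξ) := log|log ξ| if γ = 1, and F_γ(ξ) := 1 if γ > 1. -/
open MeasureTheory

/-- The integral of a nonnegative continuous derivative over a compact interval, as a Lebesgue
integral with values in `ℝ≥0∞`. -/
lemma lintegral_Icc_ofReal_eq_of_hasDerivAt {G g : ℝ → ℝ} {a b : ℝ} (hab : a ≤ b)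
    (hG : ∀ t ∈ Set.Icc a b, HasDerivAt G (g t) t) (hg : ContinuousOn g (Set.Icc a b))
    (hg0 : ∀ t ∈ Set.Icc a b, 0 ≤ g t) :
    ∫⁻ t in Set.Icc a b, ENNReal.ofReal (g t) = ENNReal.ofReal (G b - G a) := by
  have hint : IntegrableOn g (Set.Icc a b) := hg.integrableOn_Icc
  rw [← ofReal_integral_eq_lintegral_ofReal hint
    ((ae_restrict_iff' measurableSet_Icc).2 (Filter.Eventually.of_forall hg0)),
    integral_Icc_eq_integral_Ioc, ← intervalIntegral.integral_of_le hab]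
  rw [intervalIntegral.integral_eq_sub_of_hasDerivAt]
  · rwa [Set.uIcc_of_le hab]
  · exact (hg.mono (by rw [Set.uIcc_of_le hab])).intervalIntegrable

/-- The mass of the exponential density of rate `ξ` beyond `1 / ξ` is at most `1`. -/
lemma lintegral_Ioi_inv_mul_exp_le_one {ξ : ℝ} (hξ : 0 < ξ) :
    ∫⁻ t in Set.Ioi ξ⁻¹, ENNReal.ofReal (ξ * Real.exp (-(ξ * t))) ≤ 1 := by
  have hint : IntegrableOn (fun t => ξ * Real.exp (-(ξ * t))) (Set.Ioi ξ⁻¹) := by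
    have := (integrableOn_exp_mul_Ioi (a := -ξ) (by linarith) ξ⁻¹).const_mul ξ
    simpa only [neg_mul, IntegrableOn] using this
  rw [← ofReal_integral_eq_lintegral_ofReal hint
    (Filter.Eventually.of_forall fun t => by positivity), ENNReal.ofReal_le_one,
    integral_const_mul]
  have h := integral_exp_mul_Ioi (a := -ξ) (by linarith) ξ⁻¹
  simp only [neg_mul] at h
  rw [h, mul_inv_cancel₀ hξ.ne', neg_div_neg_eq, mul_div_cancel₀ _ hξ.ne']
  exact Real.exp_le_one_iff.2 (by norm_num)

/-- Splitting at `1 / ξ` bounds the Laplace integral of `1 / (t (log t)^γ)` by the increment of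
a primitive plus `1`. -/
lemma lintegral_exp_div_mul_log_rpow_le {γ t₀ ξ : ℝ} (hγ : 0 ≤ γ) (ht₀ : Real.exp 1 < t₀)
    (hξ : 0 < ξ) (hξt : t₀ < ξ⁻¹) {G : ℝ → ℝ}
    (hG : ∀ u : ℝ, 1 < u → HasDerivAt G (u ^ (-γ)) u) (hmono : G (Real.log t₀) ≤ G (-Real.log ξ)) :
    (∫⁻ t in Set.Ici t₀, ENNReal.ofReal (Real.exp (-(ξ * t)) / (t * Real.log t ^ γ)))
      ≤ ENNReal.ofReal (G (-Real.log ξ) - G (Real.log t₀) + 1) := by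
  have hpos : ∀ t, t₀ ≤ t → 0 < t := fun t ht => (Real.exp_pos 1).trans (ht₀.trans_le ht)
  have hlog : ∀ t, t₀ ≤ t → 1 < Real.log t := fun t ht =>
    (Real.lt_log_iff_exp_lt (hpos t ht)).2 (ht₀.trans_le ht)
  have hderiv : ∀ t ∈ Set.Icc t₀ ξ⁻¹,
      HasDerivAt (fun t => G (Real.log t)) (Real.log t ^ (-γ) * t⁻¹) t := fun t ht =>
    (hG _ (hlog t ht.1)).comp t (Real.hasDerivAt_log (hpos t ht.1).ne')
  have hcont : ContinuousOn (fun t => Real.log t ^ (-γ) * t⁻¹) (Set.Icc t₀ ξ⁻¹) := by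
    intro t ht
    have h1 := (hpos t ht.1).ne'
    have h2 : Real.log t ≠ 0 := (zero_lt_one.trans (hlog t ht.1)).ne'
    exact (((Real.continuousAt_log h1).rpow_const (Or.inl h2)).mul
      (continuousAt_inv₀ h1)).continuousWithinAt
  have hnonneg : ∀ t ∈ Set.Icc t₀ ξ⁻¹, 0 ≤ Real.log t ^ (-γ) * t⁻¹ := fun t ht =>
    mul_nonneg (Real.rpow_nonneg (by linarith [hlog t ht.1]) _) (inv_nonneg.2 (hpos t ht.1).le)
  have hmain := lintegral_Icc_ofReal_eq_of_hasDerivAt hξt.le hderiv hcont hnonneg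
  simp only [Real.log_inv] at hmain
  rw [← Set.Icc_union_Ioi_eq_Ici hξt.le, ENNReal.ofReal_add (by linarith) zero_le_one,
    ENNReal.ofReal_one, ← hmain]
  refine (lintegral_union_le _ _ _).trans (add_le_add ?_ ?_)
  · refine setLIntegral_mono' measurableSet_Icc fun t ht => ENNReal.ofReal_le_ofReal ?_
    have h1 := hpos t ht.1
    have h2 := hlog t ht.1
    rw [Real.rpow_neg (by linarith), ← mul_inv, mul_comm t, ← one_div]
    have h3 : 0 < Real.log t ^ γ := Real.rpow_pos_of_pos (by linarith) _
    gcongr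
    exact Real.exp_le_one_iff.2 (by nlinarith)
  · refine le_trans ?_ (lintegral_Ioi_inv_mul_exp_le_one hξ)
    refine setLIntegral_mono' measurableSet_Ioi fun t ht => ENNReal.ofReal_le_ofReal ?_
    have ht' : ξ⁻¹ < t := ht
    have htt : t₀ ≤ t := (hξt.trans ht').le
    have h3 : 1 ≤ Real.log t ^ γ := Real.one_le_rpow (hlog t htt).le hγ
    have h4 : 1 ≤ ξ * t := by
      rw [inv_lt_iff_one_lt_mul₀' hξ] at ht'
      exact ht'.le
    have h5 := hpos t htt
    rw [div_le_iff₀ (by positivity)]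
    have h6 : 1 ≤ ξ * t * Real.log t ^ γ := one_le_mul_of_one_le_of_one_le h4 h3
    nlinarith [Real.exp_pos (-(ξ * t))]

/-- For `γ ≥ 0` and every `t₀ > e`, there exists `M > 0` such that
`∫_{t₀}^∞ e^{-ξt}/(t (log t)^γ) dt ≤ M F_γ(ξ)` for all `0 < ξ < 1/t₀`, where
`F_γ(ξ) = |log ξ|^{1-γ}` if `0 ≤ γ < 1`, `F_γ(ξ) = log|log ξ|` if `γ = 1`, and
`F_γ(ξ) = 1` if `γ > 1`. -/
theorem stmt_16 (γ : ℝ) (hγ : 0 ≤ γ) :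
    ∀ t₀ : ℝ, Real.exp 1 < t₀ →
      ∃ M > 0, ∀ ξ : ℝ, 0 < ξ → ξ < 1 / t₀ →
        (∫⁻ t in Set.Ici t₀,
            ENNReal.ofReal (Real.exp (-(ξ * t)) / (t * Real.log t ^ γ)))
          ≤ ENNReal.ofReal (M *
              (if γ < 1 then |Real.log ξ| ^ (1 - γ)
               else if γ = 1 then Real.log |Real.log ξ|
               else 1)) := by
  intro t₀ ht₀
  have ht₀pos : 0 < t₀ := (Real.exp_pos 1).trans ht₀
  have ha : 1 < Real.log t₀ := (Real.lt_log_iff_exp_lt ht₀pos).2 ht₀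
  have hinv : ∀ ξ : ℝ, 0 < ξ → ξ < 1 / t₀ → t₀ < ξ⁻¹ := fun ξ hξ h => by
    rw [one_div] at h
    exact (lt_inv_comm₀ hξ ht₀pos).1 h
  have hL : ∀ ξ : ℝ, 0 < ξ → ξ < 1 / t₀ → Real.log t₀ < -Real.log ξ := fun ξ hξ h => by
    rw [← Real.log_inv]
    exact Real.log_lt_log ht₀pos (hinv ξ hξ h)
  have habs : ∀ ξ : ℝ, 0 < ξ → ξ < 1 / t₀ → |Real.log ξ| = -Real.log ξ := fun ξ hξ h =>
    abs_of_neg (by linarith [hL ξ hξ h])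
  have hpow : γ ≠ 1 → ∀ u : ℝ, 1 < u →
      HasDerivAt (fun u : ℝ => u ^ (1 - γ) / (1 - γ)) (u ^ (-γ)) u := fun h u hu => by
    have h1 : 1 - γ ≠ 0 := sub_ne_zero.2 h.symm
    have := (Real.hasDerivAt_rpow_const (x := u) (p := 1 - γ)
      (Or.inl (by linarith : (0 : ℝ) < u).ne')).div_const (1 - γ)
    rwa [mul_div_cancel_left₀ _ h1, sub_sub_cancel_left] at this
  rcases lt_trichotomy γ 1 with h | h | h
  · have hc : 0 < 1 - γ := by linarith
    refine ⟨1 / (1 - γ) + 1, by positivity, fun ξ hξ hξt => ?_⟩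
    have hl := hL ξ hξ hξt
    rw [if_pos h, habs ξ hξ hξt]
    refine (lintegral_exp_div_mul_log_rpow_le hγ ht₀ hξ (hinv ξ hξ hξt) (hpow h.ne) ?_).trans
      (ENNReal.ofReal_le_ofReal ?_)
    · gcongr
    · have h1 : 1 ≤ (-Real.log ξ) ^ (1 - γ) := Real.one_le_rpow (by linarith) hc.le
      have h2 : 0 ≤ Real.log t₀ ^ (1 - γ) / (1 - γ) := by positivity
      rw [add_mul, one_mul, one_div_mul_eq_div]
      linarith
  · subst h
    have hla : 0 < Real.log (Real.log t₀) := Real.log_pos ha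
    refine ⟨1 + 1 / Real.log (Real.log t₀), by positivity, fun ξ hξ hξt => ?_⟩
    have hl := hL ξ hξ hξt
    rw [if_neg (lt_irrefl _), if_pos rfl, habs ξ hξ hξt]
    have hll : Real.log (Real.log t₀) ≤ Real.log (-Real.log ξ) :=
      Real.log_le_log (by linarith) hl.le
    refine (lintegral_exp_div_mul_log_rpow_le hγ ht₀ hξ (hinv ξ hξ hξt) (G := Real.log)
      (fun u hu => ?_) hll).trans (ENNReal.ofReal_le_ofReal ?_)
    · rw [Real.rpow_neg_one]
      exact Real.hasDerivAt_log (by linarith : (0 : ℝ) < u).ne'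
    · have h1 : 1 ≤ Real.log (-Real.log ξ) / Real.log (Real.log t₀) := (one_le_div hla).2 hll
      rw [add_mul, one_mul, one_div_mul_eq_div]
      linarith
  · have hc : 0 < γ - 1 := by linarith
    refine ⟨1 / (γ - 1) + 1, by positivity, fun ξ hξ hξt => ?_⟩
    have hl := hL ξ hξ hξt
    rw [if_neg h.not_gt, if_neg h.ne', mul_one]
    have hneg : ∀ x : ℝ, x / (1 - γ) = -(x / (γ - 1)) := fun x => by
      rw [← div_neg, neg_sub]
    refine (lintegral_exp_div_mul_log_rpow_le hγ ht₀ hξ (hinv ξ hξ hξt) (hpow h.ne') ?_).trans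
      (ENNReal.ofReal_le_ofReal ?_)
    · simp only [hneg, neg_le_neg_iff]
      gcongr ?_ / _
      exact Real.rpow_le_rpow_of_nonpos (by linarith) hl.le (by linarith)
    · have h1 : Real.log t₀ ^ (1 - γ) / (γ - 1) ≤ 1 / (γ - 1) := by
        gcongr
        exact Real.rpow_le_one_of_one_le_of_nonpos ha.le (by linarith)
      have h2 : 0 ≤ (-Real.log ξ) ^ (1 - γ) / (γ - 1) :=
        div_nonneg (Real.rpow_nonneg (by linarith) _) hc.le
      simp only [hneg]
      linarith
end
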